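/- For each M > 0, the kinetic energy attains its maximum over the relaxed admissible class: there exists ω ∈ K̃_M such that E(ω') ≤ E(ω) for every ω' ∈ K̃_M. -/

import Mathlib

open MeasureTheory Real Set NNReal Filter Topology

noncomputable section

/-- The upper half plane `ℝ²₊`. -/
def H : Set (ℝ × ℝ) := {p | 0 < p.2}

/-- The half-plane Green function
`G(x,y) = (1/(4π)) log(1 + 4 x₂ y₂ / |x-y|²)` (Euclidean distance). -/
def G (x y : ℝ × ℝ) : ℝ :=
  (1 / (4 * π)) * Real.log (1 + 4 * x.2 * y.2 / ((x.1 - y.1) ^ 2 + (x.2 - y.2) ^ 2))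

/-- The potential `𝒢[ω](x) = ∫_{ℝ²₊} G(x,y) ω(y) dy`. -/
def Gpot (ω : ℝ × ℝ → ℝ) (x : ℝ × ℝ) : ℝ := ∫ y in H, G x y * ω y

/-- The kinetic energy `E(ω) = (1/2) ∫∫ G(x,y) ω(x) ω(y) dy dx`. -/
def energy (ω : ℝ × ℝ → ℝ) : ℝ :=
  (1 / 2) * ∫ x in H, ∫ y in H, G x y * ω x * ω y

/-- The `L¹(ℝ²₊)` norm (mass). -/
def norm1 (ω : ℝ × ℝ → ℝ) : ℝ := ∫ x in H, |ω x|

/-- The `L²(ℝ²₊)` norm. -/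
def norm2 (ω : ℝ × ℝ → ℝ) : ℝ := (∫ x in H, ω x ^ 2) ^ ((1 : ℝ) / 2)

/-- The impulse `‖x₂ ω‖₁ = ∫_{ℝ²₊} x₂ |ω(x)| dx`. -/
def impulse (ω : ℝ × ℝ → ℝ) : ℝ := ∫ x in H, x.2 * |ω x|

/-- `ω ∈ (L¹ ∩ L²)(ℝ²₊)`. -/
def MemL1L2 (ω : ℝ × ℝ → ℝ) : Prop :=
  Integrable ω (volume.restrict H) ∧ Integrable (fun x => ω x ^ 2) (volume.restrict H)

/-- Finiteness of the impulse `‖x₂ ω‖₁ < ∞`. -/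
def ImpulseFinite (ω : ℝ × ℝ → ℝ) : Prop :=
  Integrable (fun x : ℝ × ℝ => x.2 * |ω x|) (volume.restrict H)

/-- The admissible class `K_M`: patches `ω = 1_A` a.e. on `ℝ²₊` with
impulse `∫_A x₂ = M` and mass `|A| ≤ 1`. -/
def memK (M : ℝ) (ω : ℝ × ℝ → ℝ) : Prop :=
  Integrable ω (volume.restrict H) ∧
  ∃ A : Set (ℝ × ℝ), A ⊆ H ∧ MeasurableSet A ∧
    (∀ᵐ x ∂volume.restrict H, ω x = A.indicator (fun _ => (1 : ℝ)) x) ∧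
    (∫ x in A, x.2) = M ∧ volume A ≤ 1

/-- The admissible class `K_{M,∞}`: patches `ω = 1_A` a.e. on `ℝ²₊` with
impulse `∫_A x₂ = M`, without any mass bound. -/
def memKinf (M : ℝ) (ω : ℝ × ℝ → ℝ) : Prop :=
  Integrable ω (volume.restrict H) ∧
  ∃ A : Set (ℝ × ℝ), A ⊆ H ∧ MeasurableSet A ∧
    (∀ᵐ x ∂volume.restrict H, ω x = A.indicator (fun _ => (1 : ℝ)) x) ∧
    (∫ x in A, x.2) = M

/-- The relaxed admissible class `K̃_M`: measurable `0 ≤ ω ≤ 1` with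
mass `≤ 1` and impulse `≤ M`. -/
def memKt (M : ℝ) (ω : ℝ × ℝ → ℝ) : Prop :=
  Integrable ω (volume.restrict H) ∧
  (∀ᵐ x ∂volume.restrict H, 0 ≤ ω x ∧ ω x ≤ 1) ∧
  norm1 ω ≤ 1 ∧
  Integrable (fun x : ℝ × ℝ => x.2 * |ω x|) (volume.restrict H) ∧
  impulse ω ≤ M

/-- The set of maximizers `S_M` of the energy over `K_M`. -/
def memS (M : ℝ) (ω : ℝ × ℝ → ℝ) : Prop :=
  memK M ω ∧ ∀ ω' : ℝ × ℝ → ℝ, memK M ω' → energy ω' ≤ energy ω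

/-- The maximal energy `I_M` over `K_M`. -/
def Isup (M : ℝ) : ℝ := sSup (energy '' {ω | memK M ω})

/-- The maximal energy `I_{1,∞}` over `K_{1,∞}`. -/
def IsupInf : ℝ := sSup (energy '' {ω | memKinf 1 ω})

/-- The Steiner symmetry condition for a set `Ω ⊆ ℝ²₊`. -/
def SteinerSet (Ω : Set (ℝ × ℝ)) : Prop :=
  (∀ x₁ x₂ : ℝ, 0 < x₂ → (((x₁, x₂) : ℝ × ℝ) ∈ Ω ↔ ((-x₁, x₂) : ℝ × ℝ) ∈ Ω)) ∧
  (∀ x₂ : ℝ, 0 < x₂ → ∀ a b : ℝ, 0 ≤ a → a ≤ b →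
    ((b, x₂) : ℝ × ℝ) ∈ Ω → ((a, x₂) : ℝ × ℝ) ∈ Ω)

/-- The Steiner symmetry condition for a nonnegative function on `ℝ²₊`. -/
def SteinerFn (f : ℝ × ℝ → ℝ) : Prop :=
  (∀ x₁ x₂ : ℝ, 0 < x₂ → f (x₁, x₂) = f (-x₁, x₂)) ∧
  (∀ x₂ : ℝ, 0 < x₂ → ∀ a b : ℝ, 0 ≤ a → a ≤ b → f (b, x₂) ≤ f (a, x₂))


lemma log_one_add_le_sqrt {s : ℝ} (hs : 0 ≤ s) : Real.log (1 + s) ≤ √s := by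
  rw [Real.log_le_iff_le_exp (by positivity)]
  have h1 := Real.quadratic_le_exp_of_nonneg (Real.sqrt_nonneg s)
  have h2 := Real.sq_sqrt hs
  have h3 := Real.sum_le_exp_of_nonneg (Real.sqrt_nonneg s) 4
  simp [Finset.sum_range_succ, Nat.factorial] at h3
  set t := √s
  have ht : 0 ≤ t := Real.sqrt_nonneg s
  rw [← h2]
  nlinarith [mul_nonneg ht (sq_nonneg (t - 3/2))]

lemma log_one_add_sq_le_sqrt {s : ℝ} (hs : 0 ≤ s) : Real.log (1 + s) ^ 2 ≤ 4 * √s := by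
  have h1 : Real.log (1 + s) ≤ 2 * Real.log (1 + √s) := by
    rw [← Real.log_rpow (by positivity)]
    apply Real.log_le_log (by positivity)
    have := Real.sq_sqrt hs
    norm_num
    nlinarith [Real.sqrt_nonneg s]
  have h2 := log_one_add_le_sqrt (Real.sqrt_nonneg s)
  have h0 : 0 ≤ Real.log (1 + s) := Real.log_nonneg (by linarith)
  calc Real.log (1 + s) ^ 2 ≤ (2 * √(√s)) ^ 2 := by gcongr; linarith
    _ = 4 * √s := by rw [mul_pow, Real.sq_sqrt (Real.sqrt_nonneg s)]; norm_num

lemma norm_sub_sq_le (x y : ℝ × ℝ) :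
    ‖x - y‖ ^ 2 ≤ (x.1 - y.1) ^ 2 + (x.2 - y.2) ^ 2 := by
  rcases le_total ‖x.1 - y.1‖ ‖x.2 - y.2‖ with h | h
  · rw [Prod.norm_def, Prod.fst_sub, Prod.snd_sub, max_eq_right h, Real.norm_eq_abs, sq_abs]
    nlinarith [sq_nonneg (x.1 - y.1)]
  · rw [Prod.norm_def, Prod.fst_sub, Prod.snd_sub, max_eq_left h, Real.norm_eq_abs, sq_abs]
    nlinarith [sq_nonneg (x.2 - y.2)]

lemma sqrt_ratio_le {x y : ℝ × ℝ} (hx : 0 < x.2) (hy : 0 < y.2) {η : ℝ} (hη : 0 < η) :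
    √(4 * x.2 * y.2 / ((x.1 - y.1) ^ 2 + (x.2 - y.2) ^ 2)) ≤
      (η * x.2 + η⁻¹ * y.2) * ‖x - y‖⁻¹ := by
  by_cases hxy : x = y
  · subst hxy; simp
  have hn : 0 < ‖x - y‖ := norm_pos_iff.2 (sub_ne_zero.2 hxy)
  have hd := norm_sub_sq_le x y
  have hd0 : 0 < (x.1 - y.1) ^ 2 + (x.2 - y.2) ^ 2 := lt_of_lt_of_le (by positivity) hd
  apply Real.sqrt_le_iff.2 ⟨by positivity, ?_⟩
  calc 4 * x.2 * y.2 / ((x.1 - y.1) ^ 2 + (x.2 - y.2) ^ 2)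
      ≤ 4 * x.2 * y.2 / ‖x - y‖ ^ 2 := by gcongr
    _ ≤ (η * x.2 + η⁻¹ * y.2) ^ 2 / ‖x - y‖ ^ 2 := by
        gcongr
        have : η * η⁻¹ = 1 := mul_inv_cancel₀ hη.ne'
        nlinarith [sq_nonneg (η * x.2 - η⁻¹ * y.2)]
    _ = _ := by rw [mul_pow, inv_pow, div_eq_mul_inv]

lemma ratio_nonneg {x y : ℝ × ℝ} (hx : 0 < x.2) (hy : 0 < y.2) :
    0 ≤ 4 * x.2 * y.2 / ((x.1 - y.1) ^ 2 + (x.2 - y.2) ^ 2) := by positivity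

lemma green_nonneg {x y : ℝ × ℝ} (hx : 0 < x.2) (hy : 0 < y.2) : 0 ≤ G x y := by
  have := Real.log_nonneg (x := 1 + 4 * x.2 * y.2 / ((x.1 - y.1) ^ 2 + (x.2 - y.2) ^ 2))
    (by linarith [ratio_nonneg hx hy])
  unfold G
  positivity

lemma inv_four_pi_le : 1 / (4 * π) ≤ 1 / 12 := by
  have := Real.pi_gt_three
  apply one_div_le_one_div_of_le <;> linarith

/-- The half-plane Green function as a nonnegative kernel, extended by zero off the half-plane. -/
def kern (x y : ℝ × ℝ) : ℝ≥0 := if 0 < x.2 ∧ 0 < y.2 then (G x y).toNNReal else 0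

lemma coe_kern {x y : ℝ × ℝ} (hx : 0 < x.2) (hy : 0 < y.2) : (kern x y : ℝ) = G x y := by
  rw [kern, if_pos ⟨hx, hy⟩, Real.coe_toNNReal _ (green_nonneg hx hy)]

lemma kern_eq_zero_left {x y : ℝ × ℝ} (hx : ¬ 0 < x.2) : kern x y = 0 := by
  rw [kern, if_neg (fun h => hx h.1)]

lemma kern_eq_zero_right {x y : ℝ × ℝ} (hy : ¬ 0 < y.2) : kern x y = 0 := by
  rw [kern, if_neg (fun h => hy h.2)]

lemma kern_comm (x y : ℝ × ℝ) : kern x y = kern y x := by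
  unfold kern G
  simp only [and_comm, sub_sq_comm x.1, sub_sq_comm x.2, mul_right_comm]

@[fun_prop]
lemma measurable_kern : Measurable (fun p : (ℝ × ℝ) × (ℝ × ℝ) => kern p.1 p.2) := by
  unfold kern G
  refine Measurable.ite ?_ (by fun_prop) measurable_const
  exact (measurableSet_lt measurable_const (measurable_snd.comp measurable_fst)).inter
    (measurableSet_lt measurable_const (measurable_snd.comp measurable_snd))

lemma kern_le_near {η : ℝ≥0} (hη : 0 < η) (x y : ℝ × ℝ) :
    kern x y ≤ (η * x.2.toNNReal + η⁻¹ * y.2.toNNReal) * ‖x - y‖₊⁻¹ := by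
  by_cases hx : 0 < x.2
  swap; · simp [kern_eq_zero_left hx]
  by_cases hy : 0 < y.2
  swap; · simp [kern_eq_zero_right hy]
  rw [← NNReal.coe_le_coe, coe_kern hx hy]
  push_cast
  rw [Real.coe_toNNReal _ hx.le, Real.coe_toNNReal _ hy.le]
  refine le_trans ?_ (sqrt_ratio_le hx hy (NNReal.coe_pos.2 hη))
  refine le_trans ?_ (log_one_add_le_sqrt (ratio_nonneg hx hy))
  have h0 := Real.log_nonneg (x := 1 + 4 * x.2 * y.2 / ((x.1 - y.1) ^ 2 + (x.2 - y.2) ^ 2))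
    (by linarith [ratio_nonneg hx hy])
  unfold G
  nlinarith [inv_four_pi_le]

lemma kern_sq_le (x y : ℝ × ℝ) :
    kern x y ^ 2 ≤ (x.2.toNNReal + y.2.toNNReal) * ‖x - y‖₊⁻¹ := by
  by_cases hx : 0 < x.2
  swap; · simp [kern_eq_zero_left hx]
  by_cases hy : 0 < y.2
  swap; · simp [kern_eq_zero_right hy]
  rw [← NNReal.coe_le_coe]
  push_cast
  rw [coe_kern hx hy, Real.coe_toNNReal _ hx.le, Real.coe_toNNReal _ hy.le]
  have h1 := sqrt_ratio_le hx hy one_pos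
  rw [inv_one, one_mul, one_mul] at h1
  refine le_trans ?_ h1
  have h2 := log_one_add_sq_le_sqrt (ratio_nonneg hx hy)
  have h3 : (1 / (4 * π)) ^ 2 ≤ (1 / 12) ^ 2 := 
    pow_le_pow_left₀ (by positivity) inv_four_pi_le 2
  unfold G
  rw [mul_pow]
  have := Real.sqrt_nonneg (4 * x.2 * y.2 / ((x.1 - y.1) ^ 2 + (x.2 - y.2) ^ 2))
  have h4 := mul_le_mul h3 h2 (by positivity) (by positivity)
  linarith

lemma kern_le_far {L : ℝ≥0} (hL : 0 < L) {x y : ℝ × ℝ} (hxy : L ≤ |x.1 - y.1|) :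
    kern x y ≤ (L ^ 2)⁻¹ * (x.2.toNNReal * y.2.toNNReal) := by
  by_cases hx : 0 < x.2
  swap; · simp [kern_eq_zero_left hx]
  by_cases hy : 0 < y.2
  swap; · simp [kern_eq_zero_right hy]
  rw [← NNReal.coe_le_coe]
  push_cast
  rw [coe_kern hx hy, Real.coe_toNNReal _ hx.le, Real.coe_toNNReal _ hy.le]
  have hL' : (0 : ℝ) < L := NNReal.coe_pos.2 hL
  have hd : (L : ℝ) ^ 2 ≤ (x.1 - y.1) ^ 2 + (x.2 - y.2) ^ 2 := by
    rw [← sq_abs (x.1 - y.1)]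
    nlinarith [sq_nonneg (x.2 - y.2)]
  have h1 : 4 * x.2 * y.2 / ((x.1 - y.1) ^ 2 + (x.2 - y.2) ^ 2) ≤ 4 * x.2 * y.2 / (L : ℝ) ^ 2 := by
    gcongr
  have h2 := Real.log_le_sub_one_of_pos
    (x := 1 + 4 * x.2 * y.2 / ((x.1 - y.1) ^ 2 + (x.2 - y.2) ^ 2))
    (by linarith [ratio_nonneg hx hy])
  have h0 := Real.log_nonneg (x := 1 + 4 * x.2 * y.2 / ((x.1 - y.1) ^ 2 + (x.2 - y.2) ^ 2))
    (by linarith [ratio_nonneg hx hy])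
  have h3 : ((L : ℝ) ^ 2)⁻¹ * (x.2 * y.2) = (1 / 4) * (4 * x.2 * y.2 / (L : ℝ) ^ 2) := by
    field_simp
  unfold G
  rw [h3]
  have : 0 ≤ 4 * x.2 * y.2 / (L : ℝ) ^ 2 := by positivity
  nlinarith [inv_four_pi_le]

lemma lintegral_ball_inv_norm {ρ : ℝ} (hρ : 0 ≤ ρ) :
    ∫⁻ z in Metric.ball (0 : ℝ × ℝ) ρ, ((‖z‖₊⁻¹ : ℝ≥0) : ENNReal) = ENNReal.ofReal (8 * ρ) := by
  have hi : IntegrableOn (fun z : ℝ × ℝ => ‖z‖⁻¹) (Metric.ball 0 ρ) := by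
    refine (integrableOn_fun_norm_addHaar volume (f := fun t => t⁻¹) (r := ρ)).2 ?_
    have : IntegrableOn (fun _ : ℝ => (1 : ℝ)) (Ioo 0 ρ) := by simp
    refine this.congr_fun (fun t ht => ?_) measurableSet_Ioo
    have : t ≠ 0 := ht.1.ne'
    simp [this]
  have hI : ∫ z in Metric.ball (0 : ℝ × ℝ) ρ, ‖z‖⁻¹ = 8 * ρ := by
    rw [← integral_indicator measurableSet_ball]
    have := integral_fun_norm_addHaar (volume : Measure (ℝ × ℝ))
      ((Iio ρ).indicator fun t : ℝ => t⁻¹)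
    have h2 : (fun x : ℝ × ℝ => (Iio ρ).indicator (fun t : ℝ => t⁻¹) ‖x‖) =
        (Metric.ball (0 : ℝ × ℝ) ρ).indicator (fun z => ‖z‖⁻¹) := by
      ext x; simp [indicator]
    rw [h2] at this
    rw [this]
    have h3 : ∫ y in Ioi (0 : ℝ), y ^ (Module.finrank ℝ (ℝ × ℝ) - 1) •
        (Iio ρ).indicator (fun t : ℝ => t⁻¹) y = ∫ y in Ioi (0 : ℝ), (Iio ρ).indicator 1 y := by
      refine setIntegral_congr_fun measurableSet_Ioi fun y hy => ?_
      have : y ≠ 0 := ne_of_gt hy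
      by_cases h : y < ρ <;> simp [indicator, h, this]
    have h4 : (volume : Measure (ℝ × ℝ)).real (Metric.ball 0 1) = 4 := by
      rw [← Prod.mk_zero_zero, ← ball_prod_same, Measure.volume_eq_prod, measureReal_prod_prod,
        Real.volume_real_ball zero_le_one]
      norm_num
    rw [h3, setIntegral_indicator measurableSet_Iio, h4]
    simp [Ioi_inter_Iio, hρ]
    ring
  rw [← hI, ofReal_integral_eq_lintegral_ofReal hi (ae_of_all _ fun z => by positivity)]
  congr 1 with z
  rw [ENNReal.ofReal, Real.toNNReal_inv, norm_toNNReal]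

lemma lintegral_mul_inv_norm_le {v : ℝ × ℝ → ℝ≥0} (hv : Measurable v) (h1 : ∀ y, v y ≤ 1) (x : ℝ × ℝ)
    {ρ : ℝ≥0} (hρ : 0 < ρ) :
    ∫⁻ y, ((v y * ‖x - y‖₊⁻¹ : ℝ≥0) : ENNReal) ≤ 8 * ρ + ((ρ⁻¹ : ℝ≥0) : ENNReal) * ∫⁻ y, v y := by
  have hb : ∫⁻ y, (Metric.ball (0 : ℝ × ℝ) ρ).indicator
      (fun z => ((‖z‖₊⁻¹ : ℝ≥0) : ENNReal)) (x - y) = 8 * ρ := by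
    rw [lintegral_sub_left_eq_self, lintegral_indicator measurableSet_ball,
      lintegral_ball_inv_norm ρ.coe_nonneg, ENNReal.ofReal_mul (by norm_num)]
    simp
  rw [← hb, ← lintegral_const_mul _ (by fun_prop), ← lintegral_add_right _ (by fun_prop)]
  refine lintegral_mono fun y => ?_
  by_cases h : x - y ∈ Metric.ball (0 : ℝ × ℝ) ρ
  · rw [indicator_of_mem h]
    refine le_add_right ?_
    exact ENNReal.coe_le_coe.2 (mul_le_of_le_one_left' (h1 y))
  · refine le_add_left ?_
    rw [mem_ball_zero_iff, not_lt, ← coe_nnnorm, NNReal.coe_le_coe] at h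
    rw [mul_comm]
    have : ‖x - y‖₊⁻¹ ≤ ρ⁻¹ := inv_anti₀ hρ h
    rw [← ENNReal.coe_mul]
    exact ENNReal.coe_le_coe.2 (mul_le_mul_left this _)

/-- The relaxed admissible class, in terms of everywhere-defined measurable `ℝ≥0`-valued
representatives vanishing off the half-plane. -/
structure Adm (M : ℝ≥0) (u : ℝ × ℝ → ℝ≥0) : Prop where
  meas : Measurable u
  le_one : ∀ x, u x ≤ 1
  supp : ∀ x, x ∉ H → u x = 0
  mass : ∫⁻ x, (u x : ENNReal) ≤ 1
  imp : ∫⁻ x, ((x.2.toNNReal * u x : ℝ≥0) : ENNReal) ≤ M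

/-- Twice the kinetic energy, as an extended nonnegative number. -/
def en (u : ℝ × ℝ → ℝ≥0) : ENNReal := ∫⁻ x, ∫⁻ y, ((kern x y * u x * u y : ℝ≥0) : ENNReal)

lemma kern_mul_le (u : ℝ × ℝ → ℝ≥0) {T : Set (ℝ × ℝ)} {L η : ℝ≥0} (hL : 0 < L) (hη : 0 < η)
    [∀ x y : ℝ × ℝ, Decidable (x ∈ T ∧ |x.1 - y.1| < L)]
    {x : ℝ × ℝ} (hx : x ∈ T) (y : ℝ × ℝ) :
    kern x y * u x * u y ≤ (L ^ 2)⁻¹ * (x.2.toNNReal * u x) * (y.2.toNNReal * u y) +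
      η * (x.2.toNNReal * u x) * (u y * ‖x - y‖₊⁻¹) +
      η⁻¹ * (y.2.toNNReal * u y) *
        ((if x ∈ T ∧ |x.1 - y.1| < L then u x else 0) * ‖y - x‖₊⁻¹) := by
  by_cases h : |x.1 - y.1| < L
  · rw [if_pos ⟨hx, h⟩, add_assoc, show ‖y - x‖₊ = ‖x - y‖₊ by rw [← nnnorm_neg, neg_sub]]
    refine le_add_left ?_
    calc kern x y * u x * u y
        ≤ ((η * x.2.toNNReal + η⁻¹ * y.2.toNNReal) * ‖x - y‖₊⁻¹) * u x * u y := by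
          gcongr; exact kern_le_near hη x y
      _ = _ := by ring
  · rw [add_assoc]
    refine le_add_right ?_
    calc kern x y * u x * u y
        ≤ ((L ^ 2)⁻¹ * (x.2.toNNReal * y.2.toNNReal)) * u x * u y := by
          gcongr; exact kern_le_far hL (not_lt.1 h)
      _ = _ := by ring

lemma lintegral_lintegral_mul_le {f : ℝ × ℝ → ENNReal} {k : ℝ × ℝ → ℝ × ℝ → ENNReal}
    (hf : Measurable f) (hk : ∀ x, Measurable (k x)) {a c : ENNReal} (ha : ∫⁻ x, f x ≤ a)
    (hc : ∀ x, ∫⁻ y, k x y ≤ c) : ∫⁻ x, ∫⁻ y, f x * k x y ≤ a * c := by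
  calc ∫⁻ x, ∫⁻ y, f x * k x y = ∫⁻ x, f x * ∫⁻ y, k x y := by
        congr 1 with x
        rw [lintegral_const_mul _ (hk x)]
    _ ≤ ∫⁻ x, f x * c := by gcongr with x; exact hc x
    _ = (∫⁻ x, f x) * c := lintegral_mul_const _ hf
    _ ≤ a * c := by gcongr

lemma lintegral_lintegral_add_three {f g h : ℝ × ℝ → ℝ × ℝ → ENNReal}
    (hf : Measurable fun p : (ℝ × ℝ) × (ℝ × ℝ) => f p.1 p.2)
    (hg : Measurable fun p : (ℝ × ℝ) × (ℝ × ℝ) => g p.1 p.2) :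
    ∫⁻ x, ∫⁻ y, (f x y + g x y + h x y) =
      (∫⁻ x, ∫⁻ y, f x y) + (∫⁻ x, ∫⁻ y, g x y) + ∫⁻ x, ∫⁻ y, h x y := by
  have hf' : Measurable fun x => ∫⁻ y, f x y := hf.lintegral_prod_right'
  have hg' : Measurable fun x => ∫⁻ y, g x y := hg.lintegral_prod_right'
  have hfg : Measurable fun x => (∫⁻ y, f x y) + ∫⁻ y, g x y := hf'.add hg'
  rw [← lintegral_add_left hf', ← lintegral_add_left hfg]
  congr 1 with x
  have h1 : Measurable (f x) := hf.comp measurable_prodMk_left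
  have h2 : Measurable (g x) := hg.comp measurable_prodMk_left
  have h3 : Measurable fun y => f x y + g x y := h1.add h2
  rw [lintegral_add_left h3, lintegral_add_left h1]

lemma tail_le {M : ℝ≥0} {u : ℝ × ℝ → ℝ≥0} (hu : Adm M u) {T : Set (ℝ × ℝ)} (hT : MeasurableSet T)
    {L η ρ : ℝ≥0} (hL : 0 < L) (hη : 0 < η) (hρ : 0 < ρ) {δ : ENNReal}
    (hδ : ∀ t : ℝ, ∫⁻ x in T ∩ {x | |x.1 - t| < L}, (u x : ENNReal) ≤ δ) :
    ∫⁻ x in T, ∫⁻ y, ((kern x y * u x * u y : ℝ≥0) : ENNReal) ≤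
      ((L ^ 2)⁻¹ : ℝ≥0) * M * M + η * M * 9 + (η⁻¹ : ℝ≥0) * M * (8 * ρ + (ρ⁻¹ : ℝ≥0) * δ) := by
  classical
  have hum := hu.meas
  set w : ℝ × ℝ → ℝ × ℝ → ℝ≥0 := fun y x => if x ∈ T ∧ |x.1 - y.1| < L then u x else 0 with hw
  have hset : ∀ y : ℝ × ℝ, MeasurableSet (T ∩ {x : ℝ × ℝ | |x.1 - y.1| < L}) := fun y =>
    hT.inter (measurableSet_lt (by fun_prop) measurable_const)
  have hwm : Measurable fun p : (ℝ × ℝ) × (ℝ × ℝ) => w p.2 p.1 := by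
    refine Measurable.ite ?_ (by fun_prop) measurable_const
    exact (measurable_fst hT).inter (measurableSet_lt
      (f := fun p : (ℝ × ℝ) × (ℝ × ℝ) => |p.1.1 - p.2.1|) (by fun_prop) measurable_const)
  have hwm' : ∀ y, Measurable (w y) := fun y =>
    hwm.comp (measurable_id.prodMk measurable_const)
  have hw1 : ∀ y x, w y x ≤ 1 := fun y x => by
    simp only [hw]; split_ifs
    exacts [hu.le_one x, zero_le_one]
  have hwδ : ∀ y : ℝ × ℝ, ∫⁻ x, (w y x : ENNReal) ≤ δ := fun y => by
    refine le_trans (le_of_eq ?_) (hδ y.1)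
    rw [← lintegral_indicator (hset y)]
    congr 1 with x
    simp only [hw, indicator, mem_inter_iff, mem_ofPred_eq]
    split_ifs <;> rfl
  have himp : Measurable fun x : ℝ × ℝ => ((x.2.toNNReal * u x : ℝ≥0) : ENNReal) := by fun_prop
  set F₁ : ℝ × ℝ → ℝ × ℝ → ENNReal := fun x y =>
    (((L ^ 2)⁻¹ * (x.2.toNNReal * u x) : ℝ≥0) : ENNReal) *
      ((y.2.toNNReal * u y : ℝ≥0) : ENNReal) with hF₁
  set F₂ : ℝ × ℝ → ℝ × ℝ → ENNReal := fun x y =>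
    ((η * (x.2.toNNReal * u x) : ℝ≥0) : ENNReal) * ((u y * ‖x - y‖₊⁻¹ : ℝ≥0) : ENNReal) with hF₂
  set F₃ : ℝ × ℝ → ℝ × ℝ → ENNReal := fun x y =>
    ((η⁻¹ * (y.2.toNNReal * u y) : ℝ≥0) : ENNReal) *
      ((w y x * ‖y - x‖₊⁻¹ : ℝ≥0) : ENNReal) with hF₃
  have hpt : ∀ x ∈ T, ∀ y, ((kern x y * u x * u y : ℝ≥0) : ENNReal) ≤
      F₁ x y + F₂ x y + F₃ x y := fun x hx y => by
    simp only [hF₁, hF₂, hF₃, ← ENNReal.coe_mul, ← ENNReal.coe_add]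
    exact ENNReal.coe_le_coe.2 (kern_mul_le u hL hη hx y)
  have hm₁ : Measurable fun p : (ℝ × ℝ) × (ℝ × ℝ) => F₁ p.1 p.2 := by fun_prop
  have hm₂ : Measurable fun p : (ℝ × ℝ) × (ℝ × ℝ) => F₂ p.1 p.2 := by fun_prop
  have hm₃ : Measurable fun p : (ℝ × ℝ) × (ℝ × ℝ) => F₃ p.1 p.2 := by
    refine Measurable.mul (by fun_prop) (Measurable.coe_nnreal_ennreal (hwm.mul ?_))
    fun_prop
  have himp' : ∀ c : ℝ≥0, ∫⁻ x : ℝ × ℝ, ((c * (x.2.toNNReal * u x) : ℝ≥0) : ENNReal) ≤ c * M :=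
    fun c => by
      simp only [ENNReal.coe_mul c]
      rw [lintegral_const_mul _ himp]
      gcongr; exact hu.imp
  refine (setLIntegral_mono' hT fun x hx => lintegral_mono fun y => hpt x hx y).trans
    ((setLIntegral_le_lintegral _ _).trans ?_)
  rw [lintegral_lintegral_add_three hm₁ hm₂]
  gcongr ?_ + ?_ + ?_
  · have := lintegral_lintegral_mul_le
      (f := fun x : ℝ × ℝ => (((L ^ 2)⁻¹ * (x.2.toNNReal * u x) : ℝ≥0) : ENNReal))
      (by fun_prop) (fun _ => himp) (himp' _) (fun _ => hu.imp)
    exact this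
  · refine lintegral_lintegral_mul_le (by fun_prop) (fun _ => by fun_prop) (himp' _) fun x => ?_
    refine (lintegral_mul_inv_norm_le hum hu.le_one x one_pos).trans ?_
    simp only [ENNReal.coe_one, mul_one, inv_one, one_mul]
    calc (8 : ENNReal) + ∫⁻ y, (u y : ENNReal) ≤ 8 + 1 := by gcongr; exact hu.mass
      _ = 9 := by norm_num
  · rw [lintegral_lintegral_swap hm₃.aemeasurable]
    refine lintegral_lintegral_mul_le (by fun_prop) (fun y => ?_) (himp' _) fun y => ?_
    · have := hwm' y
      fun_prop
    · refine (lintegral_mul_inv_norm_le (hwm' y) (hw1 y) y hρ).trans ?_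
      gcongr
      exact hwδ y

lemma exists_tail_le (M : ℝ≥0) {ε : ℝ≥0} (hε : 0 < ε) :
    ∃ L δ : ℝ≥0, 0 < L ∧ 0 < δ ∧ ∀ u, Adm M u → ∀ T, MeasurableSet T →
      (∀ t : ℝ, ∫⁻ x in T ∩ {x | |x.1 - t| < L}, (u x : ENNReal) ≤ δ) →
      ∫⁻ x in T, ∫⁻ y, ((kern x y * u x * u y : ℝ≥0) : ENNReal) ≤ ε := by
  set D := M + 1 with hD
  have hD0 : 0 < D := by positivity
  set η := ε / (27 * D) with hη
  have hη0 : 0 < η := by positivity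
  set L := 3 * D ^ 2 / ε + 1 with hLdef
  have hL : 0 < L := by positivity
  set ρ := ε * η / (48 * D) with hρ
  have hρ0 : 0 < ρ := by positivity
  set δ := ε * η * ρ / (6 * D) with hδ
  have hδ0 : 0 < δ := by positivity
  refine ⟨L, δ, hL, hδ0, fun u hu T hT hT' => (tail_le hu hT hL hη0 hρ0 hT').trans ?_⟩
  have hMD : M ≤ D := le_self_add
  have key : (L ^ 2)⁻¹ * M * M + η * M * 9 + η⁻¹ * M * (8 * ρ + ρ⁻¹ * δ) ≤ ε := by
    have h1 : (L ^ 2)⁻¹ * M * M ≤ ε / 3 := by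
      have h3 : 3 * D ^ 2 / ε ≤ L ^ 2 := by
        calc 3 * D ^ 2 / ε ≤ L := le_self_add
          _ ≤ L ^ 2 := by
            rw [sq]; exact le_mul_of_one_le_left' le_add_self
      calc (L ^ 2)⁻¹ * M * M ≤ (3 * D ^ 2 / ε)⁻¹ * D * D := by gcongr
        _ = ε / 3 := by field_simp
    have h2 : η * M * 9 ≤ ε / 3 := by
      calc η * M * 9 ≤ η * D * 9 := by gcongr
        _ = ε / 3 := by rw [hη]; field_simp; norm_num
    have h3 : η⁻¹ * M * (8 * ρ + ρ⁻¹ * δ) ≤ ε / 3 := by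
      calc _ ≤ η⁻¹ * D * (8 * ρ + ρ⁻¹ * δ) := by gcongr
        _ = η⁻¹ * D * (8 * ρ) + η⁻¹ * D * (ρ⁻¹ * δ) := by ring
        _ = ε / 6 + ε / 6 := by
          congr 1
          · rw [hρ]; field_simp; norm_num
          · rw [hδ]; field_simp
        _ = ε / 3 := by rw [← NNReal.coe_inj]; push_cast; ring
    calc _ ≤ ε / 3 + ε / 3 + ε / 3 := by gcongr
      _ = ε := by rw [← NNReal.coe_inj]; push_cast; ring
  exact_mod_cast key

lemma Adm.en_lt_top {M : ℝ≥0} : ∃ C : ℝ≥0, ∀ u, Adm M u → en u ≤ C := by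
  refine ⟨M * M + M * 9 + M * 9, fun u hu => ?_⟩
  have h := tail_le hu MeasurableSet.univ one_pos one_pos one_pos (δ := 1) (fun t =>
    (setLIntegral_le_lintegral _ _).trans hu.mass)
  rw [Measure.restrict_univ] at h
  refine h.trans (le_of_eq ?_)
  norm_num

/-- Weak convergence in `L²(ℝ²)`. -/
def WeakTendsto (u : ℕ → ℝ × ℝ → ℝ≥0) (v : ℝ × ℝ → ℝ≥0) : Prop :=
  ∀ f : ℝ × ℝ → ℝ, MemLp f 2 volume →
    Tendsto (fun n => ∫ x, (u n x : ℝ) * f x) atTop (𝓝 (∫ x, (v x : ℝ) * f x))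

lemma memLp_two_of_bounded_support {f : ℝ × ℝ → ℝ} (hf : Measurable f) {C R : ℝ}
    (hC : ∀ x, |f x| ≤ C) (hR : ∀ x, x ∉ Metric.closedBall 0 R → f x = 0) (p : ENNReal) :
    MemLp f p volume := by
  have h : (Metric.closedBall (0 : ℝ × ℝ) R).indicator f = f := by
    ext x; by_cases hx : x ∈ Metric.closedBall (0 : ℝ × ℝ) R
    · simp [indicator_of_mem hx]
    · simp [indicator_of_notMem hx, hR x hx]
  rw [← h, memLp_indicator_iff_restrict Metric.isClosed_closedBall.measurableSet]
  have : IsFiniteMeasure (volume.restrict (Metric.closedBall (0 : ℝ × ℝ) R)) :=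
    ⟨by rw [Measure.restrict_apply_univ]; exact measure_closedBall_lt_top⟩
  exact MemLp.of_bound hf.aestronglyMeasurable C (ae_of_all _ hC)

lemma WeakTendsto.lintegral_le {u : ℕ → ℝ × ℝ → ℝ≥0} {v : ℝ × ℝ → ℝ≥0} (h : WeakTendsto u v)
    (hum : ∀ n, Measurable (u n)) (hu1 : ∀ n x, u n x ≤ 1) (hvm : Measurable v)
    (hv1 : ∀ x, v x ≤ 1) {w : ℝ × ℝ → ℝ≥0} (hw : Measurable w) {c : ENNReal}
    (hc : ∀ᶠ n in atTop, ∫⁻ x, ((w x * u n x : ℝ≥0) : ENNReal) ≤ c) :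
    ∫⁻ x, ((w x * v x : ℝ≥0) : ENNReal) ≤ c := by
  set W : ℕ → ℝ × ℝ → ℝ≥0 := fun k =>
    (Metric.closedBall (0 : ℝ × ℝ) k).indicator fun x => min (w x) k with hW
  have hWm : ∀ k, Measurable (W k) := fun k =>
    (hw.min measurable_const).indicator Metric.isClosed_closedBall.measurableSet
  have hWw : ∀ k x, W k x ≤ w x := fun k x =>
    (indicator_le_self' (by simp) x).trans (min_le_left _ _)
  have hWk : ∀ k x, W k x ≤ k := fun k x =>
    (indicator_le_self' (by simp) x).trans (min_le_right _ _)
  have hW0 : ∀ (k : ℕ) (x : ℝ × ℝ), x ∉ Metric.closedBall (0 : ℝ × ℝ) k → W k x = 0 := fun k x hx =>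
    indicator_of_notMem hx _
  have hint : ∀ k (z : ℝ × ℝ → ℝ≥0), Measurable z → (∀ x, z x ≤ 1) →
      ∫⁻ x, ((W k x * z x : ℝ≥0) : ENNReal) = ENNReal.ofReal (∫ x, (z x : ℝ) * (W k x : ℝ)) := by
    intro k z hz hz1
    have hi : Integrable fun x => (z x : ℝ) * (W k x : ℝ) := by
      have := hWm k
      rw [← memLp_one_iff_integrable]
      refine memLp_two_of_bounded_support (by fun_prop) (C := k) (R := k) (fun x => ?_) (fun x hx => ?_) 1
      · rw [abs_of_nonneg (by positivity)]
        have h1 : (z x : ℝ) ≤ 1 := by exact_mod_cast hz1 x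
        have h2 : (W k x : ℝ) ≤ k := by exact_mod_cast hWk k x
        calc (z x : ℝ) * W k x ≤ 1 * k := by gcongr
          _ = k := one_mul _
      · simp [hW0 k x hx]
    rw [ofReal_integral_eq_lintegral_ofReal hi (ae_of_all _ fun x => by positivity)]
    congr 1 with x
    rw [← NNReal.coe_mul, ENNReal.ofReal_coe_nnreal, mul_comm]
  have hk : ∀ k, ∫⁻ x, ((W k x * v x : ℝ≥0) : ENNReal) ≤ c := by
    intro k
    have hL : MemLp (fun x => (W k x : ℝ)) 2 volume := by
      refine memLp_two_of_bounded_support (hWm k).coe_nnreal_real (C := k) (R := k) (fun x => ?_)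
        (fun x hx => ?_) 2
      · rw [abs_of_nonneg (by positivity)]; exact_mod_cast hWk k x
      · simp [hW0 k x hx]
    have ht := (ENNReal.continuous_ofReal.tendsto _).comp (h _ hL)
    rw [hint k v hvm hv1]
    refine le_of_tendsto ht (hc.mono fun n hn => ?_)
    simp only [Function.comp_apply]
    rw [← hint k (u n) (hum n) (hu1 n)]
    refine le_trans (lintegral_mono fun x => ?_) hn
    exact ENNReal.coe_le_coe.2 (mul_le_mul_left (hWw k x) _)
  refine le_of_tendsto' (lintegral_tendsto_of_tendsto_of_monotone (μ := volume)
    (f := fun k x => ((W k x * v x : ℝ≥0) : ENNReal)) (fun k => ?_) ?_ ?_) hk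
  · have := hWm k
    fun_prop
  · refine ae_of_all _ fun x => monotone_nat_of_le_succ fun k => ?_
    refine ENNReal.coe_le_coe.2 (mul_le_mul_left ?_ _)
    simp only [hW, indicator]
    split_ifs with h1 h2
    · gcongr; simp
    · exact absurd (Metric.closedBall_subset_closedBall (by simp) h1) h2
    · simp
    · simp
  · refine ae_of_all _ fun x => tendsto_const_nhds.congr' ?_
    obtain ⟨k₀, hk₀⟩ := exists_nat_ge (max ‖x‖ (w x))
    filter_upwards [eventually_ge_atTop k₀] with k hk
    have hk' : max ‖x‖ (w x) ≤ k := hk₀.trans (by exact_mod_cast hk)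
    have h1 : x ∈ Metric.closedBall (0 : ℝ × ℝ) k :=
      mem_closedBall_zero_iff.2 ((le_max_left _ _).trans hk')
    have h2 : w x ≤ k := by
      have := (le_max_right _ _).trans hk'
      exact_mod_cast this
    simp [hW, indicator_of_mem h1, min_eq_left h2]

lemma Adm.eLpNorm_le {M : ℝ≥0} {u : ℝ × ℝ → ℝ≥0} (hu : Adm M u) :
    eLpNorm (fun x => (u x : ℝ)) 2 volume ≤ 1 := by
  rw [eLpNorm_eq_lintegral_rpow_enorm_toReal (by norm_num) (by norm_num)]
  refine ENNReal.rpow_le_one ?_ (by positivity)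
  refine le_trans (lintegral_mono fun x => ?_) hu.mass
  have h1 : (u x : ENNReal) ≤ 1 := by exact_mod_cast hu.le_one x
  have : ‖(u x : ℝ)‖ₑ = u x := by
    rw [Real.enorm_eq_ofReal (by positivity), ENNReal.ofReal_coe_nnreal]
  rw [this]
  simp only [ENNReal.toReal_ofNat, ENNReal.rpow_ofNat]
  rw [sq]
  exact mul_le_of_le_one_left' h1

lemma Adm.memLp {M : ℝ≥0} {u : ℝ × ℝ → ℝ≥0} (hu : Adm M u) :
    MemLp (fun x => (u x : ℝ)) 2 volume :=
  ⟨hu.meas.coe_nnreal_real.aestronglyMeasurable, hu.eLpNorm_le.trans_lt ENNReal.one_lt_top⟩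

lemma exists_weak_limit_Lp {u : ℕ → ℝ × ℝ → ℝ} (hu : ∀ n, MemLp (u n) 2 volume)
    (hu1 : ∀ n, eLpNorm (u n) 2 volume ≤ 1) :
    ∃ f : ℝ × ℝ → ℝ, Measurable f ∧ MemLp f 2 volume ∧ ∃ φ : ℕ → ℕ, StrictMono φ ∧
      ∀ g : ℝ × ℝ → ℝ, MemLp g 2 volume →
        Tendsto (fun n => ∫ x, u (φ n) x * g x) atTop (𝓝 (∫ x, f x * g x)) := by
  have hne : Fact ((1 : ENNReal) ≤ 2) := ⟨by norm_num⟩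
  have hne' : Fact ((2 : ENNReal) ≠ ⊤) := ⟨by norm_num⟩
  let V := Lp ℝ 2 (volume : Measure (ℝ × ℝ))
  let F : ℕ → V := fun n => (hu n).toLp (u n)
  let D : ℕ → WeakDual ℝ V := fun n => StrongDual.toWeakDual (InnerProductSpace.toDual ℝ V (F n))
  have hD : ∀ n, D n ∈ WeakDual.toStrongDual ⁻¹' Metric.closedBall (0 : StrongDual ℝ V) 1 := by
    intro n
    rw [mem_preimage, mem_closedBall_zero_iff]
    change ‖InnerProductSpace.toDual ℝ V (F n)‖ ≤ 1
    rw [LinearIsometryEquiv.norm_map, Lp.norm_toLp]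
    exact ENNReal.toReal_le_of_le_ofReal zero_le_one (by simpa using hu1 n)
  obtain ⟨d, -, φ, hφ, hd⟩ := WeakDual.isSeqCompact_closedBall ℝ V 0 1 hD
  obtain ⟨f, hf⟩ := (InnerProductSpace.toDual ℝ V).surjective (WeakDual.toStrongDual d)
  refine ⟨f, (Lp.stronglyMeasurable f).measurable, Lp.memLp f, φ, hφ, fun g hg => ?_⟩
  have hin : ∀ k : V, ∫ x, k x * g x = inner ℝ k (hg.toLp g) := by
    intro k
    rw [L2.inner_def]
    refine integral_congr_ae ?_
    filter_upwards [hg.coeFn_toLp] with x hx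
    rw [hx, mul_comm]
    rfl
  have h1 := (WeakDual.eval_continuous (𝕜 := ℝ) (E := V) (hg.toLp g)).tendsto d |>.comp hd
  have h2 : d (hg.toLp g) = inner ℝ f (hg.toLp g) := by
    have : WeakDual.toStrongDual d (hg.toLp g) = inner ℝ f (hg.toLp g) := by
      rw [← hf]; rfl
    exact this
  rw [hin, ← h2]
  refine h1.congr fun n => ?_
  have h3 : ∫ x, u (φ n) x * g x = ∫ x, F (φ n) x * g x := by
    refine integral_congr_ae ?_
    filter_upwards [(hu (φ n)).coeFn_toLp] with x hx
    rw [← hx]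
  rw [h3, hin]
  rfl

lemma exists_weak_limit {M : ℝ≥0} {u : ℕ → ℝ × ℝ → ℝ≥0} (hu : ∀ n, Adm M (u n)) :
    ∃ v, Adm M v ∧ ∃ φ : ℕ → ℕ, StrictMono φ ∧ WeakTendsto (fun n => u (φ n)) v := by
  classical
  obtain ⟨f, hfm, hf2, φ, hφ, hlim⟩ := exists_weak_limit_Lp (fun n => (hu n).memLp)
    (fun n => (hu n).eLpNorm_le)
  have hHm : MeasurableSet H := measurableSet_lt measurable_const measurable_snd
  have hset : ∀ s, MeasurableSet s → volume s < ⊤ →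
      Tendsto (fun n => ∫ x in s, (u (φ n) x : ℝ)) atTop (𝓝 (∫ x in s, f x)) := by
    intro s hs hs'
    have := hlim (s.indicator 1) (memLp_indicator_const 2 hs 1 (Or.inr hs'.ne))
    have h2 : ∀ z : ℝ × ℝ → ℝ, ∫ x, z x * s.indicator 1 x = ∫ x in s, z x := by
      intro z
      rw [← integral_indicator hs]
      congr 1 with x
      by_cases h : x ∈ s <;> simp [h]
    simpa only [h2] using this
  have hfi : ∀ s, MeasurableSet s → volume s < ⊤ → IntegrableOn f s := by
    intro s hs hs'
    have : IsFiniteMeasure (volume.restrict s) := ⟨by simpa using hs'⟩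
    exact (hf2.restrict s).integrable (by norm_num)
  have hui : ∀ n s, MeasurableSet s → volume s < ⊤ → IntegrableOn (fun x => (u n x : ℝ)) s := by
    intro n s hs hs'
    have : IsFiniteMeasure (volume.restrict s) := ⟨by simpa using hs'⟩
    exact ((hu n).memLp.restrict s).integrable (by norm_num)
  have hf0 : 0 ≤ᵐ[volume] f :=
    ae_nonneg_of_forall_setIntegral_nonneg_of_sigmaFinite hfi fun s hs hs' =>
      ge_of_tendsto' (hset s hs hs') fun n => integral_nonneg fun x => NNReal.coe_nonneg _
  have h1i : ∀ s : Set (ℝ × ℝ), volume s < ⊤ → Integrable (fun _ => (1 : ℝ)) (volume.restrict s) :=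
    fun s hs' => integrableOn_const hs'.ne
  have hf1 : 0 ≤ᵐ[volume] fun x => 1 - f x := by
    refine ae_nonneg_of_forall_setIntegral_nonneg_of_sigmaFinite (fun s hs hs' => ?_)
      fun s hs hs' => ?_
    · exact (h1i s hs').sub (hfi s hs hs')
    · rw [integral_sub (h1i s hs') (hfi s hs hs'), sub_nonneg]
      refine le_of_tendsto' (hset s hs hs') fun n => ?_
      refine setIntegral_mono (hui _ s hs hs') (h1i s hs') fun x => ?_
      exact_mod_cast (hu (φ n)).le_one x
  set v : ℝ × ℝ → ℝ≥0 := H.indicator fun x => min (f x).toNNReal 1 with hv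
  have hvm : Measurable v := (hfm.real_toNNReal.min measurable_const).indicator hHm
  have hv1 : ∀ x, v x ≤ 1 := fun x =>
    (indicator_le_self' (by simp) x).trans (min_le_right _ _)
  have hw : WeakTendsto (fun n => u (φ n)) v := by
    intro g hg
    have := hlim (H.indicator g) (hg.indicator hHm)
    have h1 : ∀ n, ∫ x, (u (φ n) x : ℝ) * H.indicator g x = ∫ x, (u (φ n) x : ℝ) * g x := by
      intro n
      congr 1 with x
      by_cases h : x ∈ H
      · simp [h]
      · simp [h, (hu (φ n)).supp x h]
    have h2 : ∫ x, f x * H.indicator g x = ∫ x, (v x : ℝ) * g x := by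
      refine integral_congr_ae ?_
      filter_upwards [hf0, hf1] with x h0 h1
      by_cases h : x ∈ H
      · have h0' : 0 ≤ f x := h0
        have h1' : f x ≤ 1 := sub_nonneg.1 h1
        simp [hv, h, h0', h1']
      · simp [hv, h]
    simpa only [h1, h2] using this
  refine ⟨v, ⟨hvm, hv1, fun x hx => indicator_of_notMem hx _, ?_, ?_⟩, φ, hφ, hw⟩
  · have := hw.lintegral_le (fun n => (hu _).meas) (fun n => (hu _).le_one) hvm hv1
      (w := fun _ => 1) measurable_const (c := 1)
      (Eventually.of_forall fun n => by simpa using (hu (φ n)).mass)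
    simpa using this
  · exact hw.lintegral_le (fun n => (hu _).meas) (fun n => (hu _).le_one) hvm hv1
      (w := fun x => x.2.toNNReal) (by fun_prop) (c := M)
      (Eventually.of_forall fun n => (hu (φ n)).imp)

lemma integral_integral_eq_toReal {μ : Measure (ℝ × ℝ)} [SFinite μ] {k : ℝ × ℝ → ℝ × ℝ → ℝ≥0}
    (hk : Measurable fun p : (ℝ × ℝ) × (ℝ × ℝ) => k p.1 p.2)
    (hfin : ∫⁻ x, ∫⁻ y, (k x y : ENNReal) ∂μ ∂μ ≠ ⊤) :
    ∫ x, ∫ y, (k x y : ℝ) ∂μ ∂μ = (∫⁻ x, ∫⁻ y, (k x y : ENNReal) ∂μ ∂μ).toReal := by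
  have hm : Measurable fun x => ∫⁻ y, (k x y : ENNReal) ∂μ :=
    (Measurable.coe_nnreal_ennreal hk).lintegral_prod_right'
  rw [← integral_toReal hm.aemeasurable (ae_lt_top hm hfin)]
  congr 1 with x
  have hkx : Measurable (k x) := hk.comp measurable_prodMk_left
  rw [integral_eq_lintegral_of_nonneg_ae (ae_of_all _ fun y => NNReal.coe_nonneg _)
    hkx.coe_nnreal_real.aestronglyMeasurable]
  simp only [ENNReal.ofReal_coe_nnreal]

/-- The contribution to the energy of pairs of points of the box of half-side `A`. -/
def enBox (A : ℝ) (u : ℝ × ℝ → ℝ≥0) : ENNReal :=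
  ∫⁻ x in Metric.closedBall 0 A, ∫⁻ y in Metric.closedBall 0 A,
    ((kern x y * u x * u y : ℝ≥0) : ENNReal)

lemma enBox_le (A : ℝ) (u : ℝ × ℝ → ℝ≥0) : enBox A u ≤ en u :=
  (setLIntegral_le_lintegral _ _).trans (lintegral_mono fun _ => setLIntegral_le_lintegral _ _)

lemma measurable_pair {u : ℝ × ℝ → ℝ≥0} (hu : Measurable u) :
    Measurable fun p : (ℝ × ℝ) × (ℝ × ℝ) => kern p.1 p.2 * u p.1 * u p.2 := by
  fun_prop

lemma en_le_enBox_add {u : ℝ × ℝ → ℝ≥0} (hu : Measurable u) (A : ℝ) :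
    en u ≤ enBox A u + 2 * ∫⁻ x in (Metric.closedBall 0 A)ᶜ, ∫⁻ y,
      ((kern x y * u x * u y : ℝ≥0) : ENNReal) := by
  set B := Metric.closedBall (0 : ℝ × ℝ) A
  have hB : MeasurableSet B := Metric.isClosed_closedBall.measurableSet
  have hk := Measurable.coe_nnreal_ennreal (measurable_pair hu)
  have hm : ∀ s, Measurable fun x => ∫⁻ y in s, ((kern x y * u x * u y : ℝ≥0) : ENNReal) :=
    fun s => hk.lintegral_prod_right' (ν := volume.restrict s)
  have h1 : ∫⁻ x in B, ∫⁻ y in Bᶜ, ((kern x y * u x * u y : ℝ≥0) : ENNReal) ≤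
      ∫⁻ x in Bᶜ, ∫⁻ y, ((kern x y * u x * u y : ℝ≥0) : ENNReal) := by
    refine (setLIntegral_le_lintegral _ _).trans (le_of_eq ?_)
    rw [lintegral_lintegral_swap hk.aemeasurable]
    congr 1 with x
    congr 1 with y
    rw [kern_comm, mul_right_comm]
  calc en u = (∫⁻ x in B, ∫⁻ y, ((kern x y * u x * u y : ℝ≥0) : ENNReal)) +
        ∫⁻ x in Bᶜ, ∫⁻ y, ((kern x y * u x * u y : ℝ≥0) : ENNReal) :=
        (lintegral_add_compl _ hB).symm
    _ = (enBox A u + ∫⁻ x in B, ∫⁻ y in Bᶜ, ((kern x y * u x * u y : ℝ≥0) : ENNReal)) +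
        ∫⁻ x in Bᶜ, ∫⁻ y, ((kern x y * u x * u y : ℝ≥0) : ENNReal) := by
        rw [enBox, ← lintegral_add_left (hm B)]
        congr 2 with x
        rw [lintegral_add_compl _ hB]
    _ ≤ _ := by
        rw [two_mul, ← add_assoc]
        gcongr

lemma exists_lintegral_kern_sq_le (A : ℝ) : ∃ K : ℝ≥0, ∀ x ∈ Metric.closedBall (0 : ℝ × ℝ) A,
    ∫⁻ y in Metric.closedBall (0 : ℝ × ℝ) A, ((kern x y ^ 2 : ℝ≥0) : ENNReal) ≤ K := by
  set B := Metric.closedBall (0 : ℝ × ℝ) A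
  have hB : MeasurableSet B := Metric.isClosed_closedBall.measurableSet
  have hvol : volume B ≠ ⊤ := measure_closedBall_lt_top.ne
  refine ⟨2 * A.toNNReal * (8 + (volume B).toNNReal), fun x hx => ?_⟩
  have hsnd : ∀ z ∈ B, z.2 ≤ A := fun z hz =>
    (le_abs_self _).trans ((norm_snd_le z).trans (mem_closedBall_zero_iff.1 hz))
  have h1 := lintegral_mul_inv_norm_le (v := B.indicator 1) (measurable_one.indicator hB)
    (fun y => indicator_le_self' (by simp) y) x one_pos
  have h2 : ∫⁻ y, ((B.indicator (1 : ℝ × ℝ → ℝ≥0) y : ℝ≥0) : ENNReal) = volume B := by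
    rw [← lintegral_indicator_one hB]
    congr 1 with y
    by_cases h : y ∈ B <;> simp [h]
  rw [h2] at h1
  calc ∫⁻ y in B, ((kern x y ^ 2 : ℝ≥0) : ENNReal)
      ≤ ∫⁻ y in B, ((2 * A.toNNReal : ℝ≥0) : ENNReal) *
          ((B.indicator (1 : ℝ × ℝ → ℝ≥0) y * ‖x - y‖₊⁻¹ : ℝ≥0) : ENNReal) := by
        refine setLIntegral_mono' hB fun y hy => ?_
        rw [indicator_of_mem hy, ← ENNReal.coe_mul]
        refine ENNReal.coe_le_coe.2 ((kern_sq_le x y).trans ?_)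
        rw [Pi.one_apply, one_mul, two_mul]
        gcongr
        exacts [hsnd x hx, hsnd y hy]
    _ ≤ ∫⁻ y, ((2 * A.toNNReal : ℝ≥0) : ENNReal) *
          ((B.indicator (1 : ℝ × ℝ → ℝ≥0) y * ‖x - y‖₊⁻¹ : ℝ≥0) : ENNReal) :=
        setLIntegral_le_lintegral _ _
    _ ≤ _ := by
        have : Measurable (B.indicator (1 : ℝ × ℝ → ℝ≥0)) := measurable_one.indicator hB
        rw [lintegral_const_mul _ (by fun_prop), ENNReal.coe_mul (2 * A.toNNReal) (8 + _),
          ENNReal.coe_add, ENNReal.coe_toNNReal hvol]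
        gcongr
        simpa using h1

lemma tendsto_enBox {M : ℝ≥0} {u : ℕ → ℝ × ℝ → ℝ≥0} {v : ℝ × ℝ → ℝ≥0} (hu : ∀ n, Adm M (u n))
    (hv : Adm M v) (h : WeakTendsto u v) (A : ℝ) :
    Tendsto (fun n => (enBox A (u n)).toReal) atTop (𝓝 (enBox A v).toReal) := by
  obtain ⟨K, hK⟩ := exists_lintegral_kern_sq_le A
  obtain ⟨C, hC⟩ := Adm.en_lt_top (M := M)
  set B := Metric.closedBall (0 : ℝ × ℝ) A
  have hB : MeasurableSet B := Metric.isClosed_closedBall.measurableSet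
  have hvol : volume B ≠ ⊤ := measure_closedBall_lt_top.ne
  have hfinB : IsFiniteMeasure (volume.restrict B) := ⟨by simpa using hvol.lt_top⟩
  have hkx : ∀ x, Measurable (kern x) := fun x => measurable_kern.comp measurable_prodMk_left
  have hL2 : ∀ x ∈ B, MemLp (fun y => (kern x y : ℝ)) 2 (volume.restrict B) := by
    intro x hx
    rw [memLp_two_iff_integrable_sq (hkx x).coe_nnreal_real.aestronglyMeasurable]
    refine ⟨by have := hkx x; fun_prop, ?_⟩
    refine lt_of_le_of_lt (le_of_eq ?_) ((hK x hx).trans_lt ENNReal.coe_lt_top)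
    congr 1 with y
    rw [Real.enorm_eq_ofReal (by positivity)]
    change ENNReal.ofReal ((kern x y : ℝ) ^ 2) = _
    rw [← NNReal.coe_pow, ENNReal.ofReal_coe_nnreal]
  have hL1 : ∀ x ∈ B, Integrable (fun y => (kern x y : ℝ)) (volume.restrict B) := fun x hx =>
    (hL2 x hx).integrable (by norm_num)
  set Φ : (ℝ × ℝ → ℝ≥0) → ℝ × ℝ → ℝ := fun w x => ∫ y in B, (w y : ℝ) * kern x y with hΦ
  set N : ℝ := K + (volume B).toReal with hN
  have hΦm : ∀ w, Measurable w → Measurable (Φ w) := by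
    intro w hw
    have : Measurable fun p : (ℝ × ℝ) × (ℝ × ℝ) => (w p.2 : ℝ) * kern p.1 p.2 := by fun_prop
    exact (this.stronglyMeasurable.integral_prod_right' (ν := volume.restrict B)).measurable
  have hkb : ∀ x ∈ B, ∫ y in B, (kern x y : ℝ) ≤ N := by
    intro x hx
    have h1 : ∫ y in B, (kern x y : ℝ) ^ 2 ≤ K := by
      rw [integral_eq_lintegral_of_nonneg_ae (ae_of_all _ fun y => by positivity)
        (by have := hkx x; fun_prop)]
      refine ENNReal.toReal_le_of_le_ofReal K.coe_nonneg ?_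
      rw [ENNReal.ofReal_coe_nnreal]
      refine le_trans (le_of_eq ?_) (hK x hx)
      congr 1 with y
      rw [← NNReal.coe_pow, ENNReal.ofReal_coe_nnreal]
    calc ∫ y in B, (kern x y : ℝ) ≤ ∫ y in B, ((kern x y : ℝ) ^ 2 + 1) := by
          refine integral_mono (hL1 x hx) ((hL2 x hx).integrable_sq.add (integrable_const 1))
            fun y => ?_
          change (kern x y : ℝ) ≤ (kern x y : ℝ) ^ 2 + 1
          nlinarith [sq_nonneg ((kern x y : ℝ) - 1)]
      _ = (∫ y in B, (kern x y : ℝ) ^ 2) + (volume B).toReal := by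
          rw [integral_add (hL2 x hx).integrable_sq (integrable_const 1)]
          simp [Measure.real]
      _ ≤ N := by rw [hN]; gcongr
  have hΦb : ∀ w, Adm M w → ∀ x ∈ B, |Φ w x| ≤ N := by
    intro w hw x hx
    rw [abs_of_nonneg (integral_nonneg fun y => by positivity)]
    refine le_trans ?_ (hkb x hx)
    have hle : ∀ y, (w y : ℝ) * kern x y ≤ kern x y := fun y => by
      have : (w y : ℝ) ≤ 1 := by exact_mod_cast hw.le_one y
      exact mul_le_of_le_one_left (by positivity) this
    exact integral_mono_of_nonneg (ae_of_all _ fun y => by positivity) (hL1 x hx)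
      (ae_of_all _ hle)
  have hN0 : 0 ≤ N := by positivity
  have hΦt : ∀ x ∈ B, Tendsto (fun n => Φ (u n) x) atTop (𝓝 (Φ v x)) := by
    intro x hx
    have h1 := h (B.indicator fun y => (kern x y : ℝ))
      ((memLp_indicator_iff_restrict hB).2 (hL2 x hx))
    have h2 : ∀ w : ℝ × ℝ → ℝ≥0,
        ∫ y, (w y : ℝ) * B.indicator (fun y => (kern x y : ℝ)) y = Φ w x := by
      intro w
      simp only [hΦ]
      rw [← integral_indicator hB]
      congr 1 with y
      by_cases hy : y ∈ B <;> simp [hy]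
    simpa only [h2] using h1
  have hform : ∀ w, Adm M w → (enBox A w).toReal = ∫ x in B, (w x : ℝ) * Φ w x := by
    intro w hw
    rw [enBox, ← integral_integral_eq_toReal (measurable_pair hw.meas)
      (((enBox_le A w).trans (hC w hw)).trans_lt ENNReal.coe_lt_top).ne]
    refine setIntegral_congr_fun hB fun x _ => ?_
    simp only [hΦ]
    rw [← integral_const_mul]
    congr 1 with y
    push_cast; ring
  rw [hform v hv]
  simp only [fun n => hform (u n) (hu n)]
  have hint : ∀ w w', Adm M w → Adm M w' →
      Integrable (fun x => (w x : ℝ) * Φ w' x) (volume.restrict B) := by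
    intro w w' hw hw'
    have h1 := hw.meas
    have h2 := hΦm w' hw'.meas
    refine Integrable.of_bound (by fun_prop) N ?_
    filter_upwards [ae_restrict_mem hB] with x hx
    rw [norm_mul, Real.norm_eq_abs, Real.norm_eq_abs, NNReal.abs_eq]
    have : (w x : ℝ) ≤ 1 := by exact_mod_cast hw.le_one x
    calc (w x : ℝ) * |Φ w' x| ≤ 1 * N := by
          gcongr
          exact hΦb w' hw' x hx
      _ = N := one_mul _
  have hA1 : Tendsto (fun n => ∫ x in B, (u n x : ℝ) * Φ v x) atTop
      (𝓝 (∫ x in B, (v x : ℝ) * Φ v x)) := by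
    have h1 := h (B.indicator (Φ v)) (memLp_two_of_bounded_support (C := N) (R := A)
      ((hΦm v hv.meas).indicator hB) (fun x => ?_) (fun x hx => indicator_of_notMem hx _) 2)
    · have h2 : ∀ w : ℝ × ℝ → ℝ≥0,
          ∫ x, (w x : ℝ) * B.indicator (Φ v) x = ∫ x in B, (w x : ℝ) * Φ v x := by
        intro w
        rw [← integral_indicator hB]
        congr 1 with y
        by_cases hy : y ∈ B <;> simp [hy]
      simpa only [h2] using h1
    · by_cases hx : x ∈ B
      · rw [indicator_of_mem hx]; exact hΦb v hv x hx
      · rw [indicator_of_notMem hx]; simpa using hN0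
  have hA2 : Tendsto (fun n => ∫ x in B, (u n x : ℝ) * (Φ (u n) x - Φ v x)) atTop (𝓝 0) := by
    have : Tendsto (fun n => ∫ x in B, (u n x : ℝ) * (Φ (u n) x - Φ v x)) atTop
        (𝓝 (∫ x in B, (0 : ℝ))) := by
      refine tendsto_integral_of_dominated_convergence (fun _ => 2 * N) (fun n => ?_)
        (integrable_const _) (fun n => ?_) ?_
      · have h1 := (hu n).meas
        have h2 := hΦm _ (hu n).meas
        have h3 := hΦm _ hv.meas
        fun_prop
      · filter_upwards [ae_restrict_mem hB] with x hx
        have h1 : (u n x : ℝ) ≤ 1 := by exact_mod_cast (hu n).le_one x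
        have h2 := hΦb _ (hu n) x hx
        have h3 := hΦb _ hv x hx
        rw [norm_mul, Real.norm_eq_abs, Real.norm_eq_abs, NNReal.abs_eq]
        have h4 : |Φ (u n) x - Φ v x| ≤ 2 * N := (abs_sub _ _).trans (by linarith)
        calc (u n x : ℝ) * |Φ (u n) x - Φ v x| ≤ 1 * (2 * N) := by gcongr
          _ = 2 * N := one_mul _
      · filter_upwards [ae_restrict_mem hB] with x hx
        have h1 : Tendsto (fun n => Φ (u n) x - Φ v x) atTop (𝓝 0) := by
          simpa using (hΦt x hx).sub_const (Φ v x)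
        refine squeeze_zero_norm (a := fun n => |Φ (u n) x - Φ v x|) (fun n => ?_) (by simpa using h1.abs)
        have h2 : (u n x : ℝ) ≤ 1 := by exact_mod_cast (hu n).le_one x
        rw [norm_mul, Real.norm_eq_abs, Real.norm_eq_abs, NNReal.abs_eq]
        exact mul_le_of_le_one_left (abs_nonneg _) h2
    simpa using this
  have := hA1.add hA2
  rw [add_zero] at this
  refine this.congr fun n => ?_
  rw [← integral_add (hint _ _ (hu n) hv)]
  · congr 1 with x; ring
  · simp only [mul_sub]
    exact (hint _ _ (hu n) (hu n)).sub (hint _ _ (hu n) hv)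

/-- Horizontal tails of a sequence vanish locally in mass, uniformly along the sequence. -/
def TailsVanish (u : ℕ → ℝ × ℝ → ℝ≥0) : Prop :=
  ∀ L δ : ℝ≥0, 0 < L → 0 < δ → ∃ A : ℝ, ∀ n (t : ℝ),
    ∫⁻ x in {x : ℝ × ℝ | A < |x.1|} ∩ {x | |x.1 - t| < L}, (u n x : ENNReal) ≤ δ

lemma Adm.lintegral_high_le {M : ℝ≥0} {u : ℝ × ℝ → ℝ≥0} (hu : Adm M u) {A : ℝ≥0} (hA : 0 < A) :
    ∫⁻ x in {x : ℝ × ℝ | (A : ℝ) < |x.2|}, (u x : ENNReal) ≤ ((A⁻¹ * M : ℝ≥0) : ENNReal) := by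
  have hs : MeasurableSet {x : ℝ × ℝ | (A : ℝ) < |x.2|} :=
    measurableSet_lt measurable_const (by fun_prop)
  have hum := hu.meas
  calc ∫⁻ x in {x : ℝ × ℝ | (A : ℝ) < |x.2|}, (u x : ENNReal)
      ≤ ∫⁻ x in {x : ℝ × ℝ | (A : ℝ) < |x.2|},
        ((A⁻¹ : ℝ≥0) : ENNReal) * ((x.2.toNNReal * u x : ℝ≥0) : ENNReal) := by
        refine setLIntegral_mono' hs fun x hx => ?_
        rw [← ENNReal.coe_mul]
        refine ENNReal.coe_le_coe.2 ?_
        by_cases hxH : x ∈ H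
        · have h0 : 0 < x.2 := hxH
          have h1 : A ≤ x.2.toNNReal := by
            refine NNReal.le_toNNReal_of_coe_le ?_
            have : (A : ℝ) < |x.2| := hx
            rw [abs_of_pos h0] at this
            exact this.le
          rw [← mul_assoc]
          refine le_mul_of_one_le_left' ?_
          rw [inv_mul_eq_div, one_le_div hA]
          exact h1
        · simp [hu.supp x hxH]
    _ ≤ ∫⁻ x : ℝ × ℝ, ((A⁻¹ : ℝ≥0) : ENNReal) * ((x.2.toNNReal * u x : ℝ≥0) : ENNReal) :=
        setLIntegral_le_lintegral _ _
    _ ≤ _ := by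
        rw [lintegral_const_mul _ (by fun_prop), ENNReal.coe_mul]
        gcongr
        exact hu.imp

lemma tendsto_en {M : ℝ≥0} {u : ℕ → ℝ × ℝ → ℝ≥0} {v : ℝ × ℝ → ℝ≥0} (hu : ∀ n, Adm M (u n))
    (hv : Adm M v) (h : WeakTendsto u v) (ht : TailsVanish u) :
    Tendsto (fun n => (en (u n)).toReal) atTop (𝓝 (en v).toReal) := by
  obtain ⟨C, hC⟩ := Adm.en_lt_top (M := M)
  have hfin : ∀ w, Adm M w → en w ≠ ⊤ := fun w hw =>
    ((hC w hw).trans_lt ENNReal.coe_lt_top).ne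
  rw [Metric.tendsto_atTop]
  intro ε hε
  obtain ⟨L, δ, hL, hδ, htail⟩ := exists_tail_le M (ε := (ε / 8).toNNReal)
    (Real.toNNReal_pos.2 (by linarith))
  obtain ⟨A₀, hA₀⟩ := ht L (δ / 2) hL (by positivity)
  set A : ℝ≥0 := A₀.toNNReal + 2 * M / δ + 1 with hA
  have hA0 : 0 < A := by positivity
  have hAA : A₀ ≤ A := by
    refine (Real.le_coe_toNNReal A₀).trans ?_
    rw [hA, add_assoc]; exact_mod_cast le_self_add
  have hAM : A⁻¹ * M ≤ δ / 2 := by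
    have h1 : 2 * M / δ ≤ A := by rw [hA, add_right_comm]; exact le_add_self
    rw [inv_mul_le_iff₀ hA0]
    rw [div_le_iff₀ hδ] at h1
    rw [mul_div_assoc', le_div_iff₀ two_pos]
    linarith
  have hstrip : ∀ w, Adm M w →
      (∀ t : ℝ, ∫⁻ x in {x : ℝ × ℝ | A₀ < |x.1|} ∩ {x | |x.1 - t| < L}, (w x : ENNReal) ≤
        ((δ / 2 : ℝ≥0) : ENNReal)) →
      ∫⁻ x in (Metric.closedBall 0 (A : ℝ))ᶜ, ∫⁻ y, ((kern x y * w x * w y : ℝ≥0) : ENNReal) ≤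
        ((ε / 8).toNNReal : ENNReal) := by
    intro w hw hwt
    refine htail w hw _ Metric.isClosed_closedBall.measurableSet.compl fun t => ?_
    have hsub : (Metric.closedBall (0 : ℝ × ℝ) (A : ℝ))ᶜ ∩ {x | |x.1 - t| < L} ⊆
        ({x : ℝ × ℝ | A₀ < |x.1|} ∩ {x | |x.1 - t| < L}) ∪ {x : ℝ × ℝ | (A : ℝ) < |x.2|} := by
      rintro x ⟨hx1, hx2⟩
      rw [mem_compl_iff, mem_closedBall_zero_iff, Prod.norm_def, max_le_iff, not_and_or, not_le,
        not_le] at hx1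
      rcases hx1 with hx1 | hx1
      · exact Or.inl ⟨hAA.trans_lt hx1, hx2⟩
      · exact Or.inr hx1
    calc _ ≤ ∫⁻ x in ({x : ℝ × ℝ | A₀ < |x.1|} ∩ {x | |x.1 - t| < L}) ∪
            {x : ℝ × ℝ | (A : ℝ) < |x.2|}, (w x : ENNReal) := lintegral_mono_set hsub
      _ ≤ _ := lintegral_union_le _ _ _
      _ ≤ ((δ / 2 : ℝ≥0) : ENNReal) + ((δ / 2 : ℝ≥0) : ENNReal) := by
          gcongr
          · exact hwt t
          · exact (hw.lintegral_high_le hA0).trans (ENNReal.coe_le_coe.2 hAM)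
      _ = δ := by rw [← ENNReal.coe_add, add_halves]
  have hbox : ∀ w, Adm M w →
      (∀ t : ℝ, ∫⁻ x in {x : ℝ × ℝ | A₀ < |x.1|} ∩ {x | |x.1 - t| < L}, (w x : ENNReal) ≤
        ((δ / 2 : ℝ≥0) : ENNReal)) →
      (enBox A w).toReal ≤ (en w).toReal ∧ (en w).toReal ≤ (enBox A w).toReal + ε / 4 := by
    intro w hw hwt
    have hbf : enBox A w ≠ ⊤ := ((enBox_le A w).trans_lt (hfin w hw).lt_top).ne
    refine ⟨ENNReal.toReal_mono (hfin w hw) (enBox_le A w), ?_⟩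
    have h1 : en w ≤ enBox A w + ENNReal.ofReal (ε / 4) := by
      refine (en_le_enBox_add hw.meas A).trans ?_
      gcongr
      calc _ ≤ 2 * ((ε / 8).toNNReal : ENNReal) := by gcongr; exact hstrip w hw hwt
        _ = ENNReal.ofReal (ε / 4) := by
          change 2 * ENNReal.ofReal (ε / 8) = _
          rw [show (2 : ENNReal) = ENNReal.ofReal 2 by simp, ← ENNReal.ofReal_mul (by norm_num)]
          congr 1; ring
    have h2 := ENNReal.toReal_mono (by simp [hbf]) h1
    rwa [ENNReal.toReal_add hbf (by simp), ENNReal.toReal_ofReal (by linarith)] at h2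
  have hvt : ∀ t : ℝ, ∫⁻ x in {x : ℝ × ℝ | A₀ < |x.1|} ∩ {x | |x.1 - t| < L}, (v x : ENNReal) ≤
        ((δ / 2 : ℝ≥0) : ENNReal) := by
    intro t
    set S := {x : ℝ × ℝ | A₀ < |x.1|} ∩ {x : ℝ × ℝ | |x.1 - t| < L}
    have hS : MeasurableSet S := (measurableSet_lt measurable_const (by fun_prop)).inter
      (measurableSet_lt (by fun_prop) measurable_const)
    have hind : ∀ w : ℝ × ℝ → ℝ≥0,
        ∫⁻ x, ((S.indicator 1 x * w x : ℝ≥0) : ENNReal) = ∫⁻ x in S, (w x : ENNReal) := by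
      intro w
      rw [← lintegral_indicator hS]
      congr 1 with x
      by_cases hx : x ∈ S <;> simp [hx]
    rw [← hind]
    refine h.lintegral_le (fun n => (hu n).meas) (fun n => (hu n).le_one) hv.meas hv.le_one
      (measurable_one.indicator hS) (Eventually.of_forall fun n => ?_)
    rw [hind]
    exact hA₀ n t
  obtain ⟨N, hN⟩ := Metric.tendsto_atTop.1 (tendsto_enBox hu hv h A) (ε / 4) (by linarith)
  refine ⟨N, fun n hn => ?_⟩
  have h1 := hbox v hv hvt
  have h2 := hbox (u n) (hu n) (hA₀ n)
  have h3 := hN n hn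
  rw [Real.dist_eq, abs_lt] at h3 ⊢
  constructor <;> linarith [h1.1, h1.2, h2.1, h2.2, h3.1, h3.2]

/-- Reflection across the vertical line `x₁ = a`. -/
def hrefl (a : ℝ) (x : ℝ × ℝ) : ℝ × ℝ := (2 * a - x.1, x.2)

lemma hrefl_hrefl (a : ℝ) (x : ℝ × ℝ) : hrefl a (hrefl a x) = x := by
  ext <;> simp [hrefl]

lemma measurePreserving_hrefl (a : ℝ) : MeasurePreserving (hrefl a) volume volume :=
  (Measure.measurePreserving_sub_left volume (2 * a)).prod (MeasurePreserving.id volume)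

@[fun_prop]
lemma measurable_hrefl (a : ℝ) : Measurable (hrefl a) := (measurePreserving_hrefl a).measurable

lemma two_mul_lintegral_eq_hrefl (a : ℝ) {f : ℝ × ℝ → ENNReal} (hf : Measurable f) :
    2 * ∫⁻ x, f x = ∫⁻ x, (f x + f (hrefl a x)) := by
  rw [lintegral_add_left hf, (measurePreserving_hrefl a).lintegral_comp hf, two_mul]

lemma kern_hrefl_hrefl (a : ℝ) (x y : ℝ × ℝ) : kern (hrefl a x) (hrefl a y) = kern x y := by
  have h : (2 * a - x.1 - (2 * a - y.1)) ^ 2 = (x.1 - y.1) ^ 2 := by ring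
  simp only [kern, G, hrefl, h]

lemma kern_hrefl_left (a : ℝ) (x y : ℝ × ℝ) : kern (hrefl a x) y = kern x (hrefl a y) := by
  rw [← kern_hrefl_hrefl a x (hrefl a y), hrefl_hrefl]

lemma kern_le_kern {x y z : ℝ × ℝ} (hyz : z.2 = y.2) (hxy : x ≠ y)
    (h : (x.1 - y.1) ^ 2 ≤ (x.1 - z.1) ^ 2) : kern x z ≤ kern x y := by
  by_cases hx : 0 < x.2
  · by_cases hy : 0 < y.2
    · have hd : 0 < (x.1 - y.1) ^ 2 + (x.2 - y.2) ^ 2 := by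
        by_contra! h0
        apply hxy
        have h1 : x.1 - y.1 = 0 := by nlinarith [sq_nonneg (x.1 - y.1), sq_nonneg (x.2 - y.2)]
        have h2 : x.2 - y.2 = 0 := by nlinarith [sq_nonneg (x.1 - y.1), sq_nonneg (x.2 - y.2)]
        exact Prod.ext (by linarith) (by linarith)
      rw [← NNReal.coe_le_coe, coe_kern hx hy, coe_kern hx (hyz ▸ hy), G, G, hyz]
      have h4 : 0 < 4 * x.2 * y.2 := by positivity
      gcongr
    · rw [kern_eq_zero_right (hyz ▸ hy)]; exact zero_le
  · rw [kern_eq_zero_left hx]; exact zero_le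

lemma rearrangement_le {α β p q r s : ℝ≥0} (h : β ≤ α) :
    α * (p * r + q * s) + β * (p * s + q * r) ≤
      α * (max p q * max r s + min p q * min r s) +
        β * (max p q * min r s + min p q * max r s) := by
  obtain ⟨γ, rfl⟩ := exists_add_of_le h
  rcases le_total p q with h1 | h1 <;> rcases le_total r s with h2 | h2 <;>
    simp only [h1, h2, max_eq_left, max_eq_right, min_eq_left, min_eq_right] <;>
    obtain ⟨c, rfl⟩ := exists_add_of_le h1 <;> obtain ⟨d, rfl⟩ := exists_add_of_le h2 <;>
    first
    | exact le_iff_exists_add.2 ⟨0, by ring1⟩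
    | exact le_iff_exists_add.2 ⟨γ * (c * d), by ring1⟩

/-- Polarization of `u` across the line `x₁ = a`: the larger of the values at a point and at its
reflection is put on the side containing the vertical axis. -/
def polar (a : ℝ) (u : ℝ × ℝ → ℝ≥0) (x : ℝ × ℝ) : ℝ≥0 :=
  if a * x.1 < a * a then max (u x) (u (hrefl a x)) else min (u x) (u (hrefl a x))

@[fun_prop]
lemma measurable_polar (a : ℝ) {u : ℝ × ℝ → ℝ≥0} (hu : Measurable u) : Measurable (polar a u) := by
  unfold polar
  have h1 : Measurable fun x => u (hrefl a x) := hu.comp (measurable_hrefl a)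
  exact Measurable.ite (measurableSet_lt (by fun_prop) measurable_const) (hu.max h1) (hu.min h1)

lemma polar_near {a : ℝ} (u : ℝ × ℝ → ℝ≥0) {x : ℝ × ℝ} (hx : a * x.1 < a * a) :
    polar a u x = max (u x) (u (hrefl a x)) ∧ polar a u (hrefl a x) = min (u x) (u (hrefl a x)) := by
  have h : ¬ a * (hrefl a x).1 < a * a := by simp only [hrefl]; nlinarith
  exact ⟨if_pos hx, by rw [polar, if_neg h, hrefl_hrefl, min_comm]⟩

lemma polar_far {a : ℝ} (ha : a ≠ 0) (u : ℝ × ℝ → ℝ≥0) {x : ℝ × ℝ} (hx : ¬ a * x.1 < a * a) :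
    polar a u x = min (u x) (u (hrefl a x)) ∧ polar a u (hrefl a x) = max (u x) (u (hrefl a x)) := by
  refine ⟨if_neg hx, ?_⟩
  rcases (not_lt.1 hx).eq_or_lt with h | h
  · have h1 : x.1 = a := (mul_left_cancel₀ ha h).symm
    have h2 : hrefl a x = x := Prod.ext (by simp only [hrefl]; linarith) rfl
    rw [h2, polar, if_neg hx, h2, min_self, max_self]
  · have h : a * (hrefl a x).1 < a * a := by simp only [hrefl]; nlinarith
    rw [polar, if_pos h, hrefl_hrefl, max_comm]

lemma polar_add_polar {a : ℝ} (ha : a ≠ 0) (u : ℝ × ℝ → ℝ≥0) (x : ℝ × ℝ) :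
    polar a u x + polar a u (hrefl a x) = u x + u (hrefl a x) := by
  by_cases hx : a * x.1 < a * a
  · rw [(polar_near u hx).1, (polar_near u hx).2, max_add_min]
  · rw [(polar_far ha u hx).1, (polar_far ha u hx).2, min_add_max]

lemma lintegral_mul_polar {a : ℝ} (ha : a ≠ 0) {u w : ℝ × ℝ → ℝ≥0} (hu : Measurable u)
    (hw : Measurable w) (hwa : ∀ x, w (hrefl a x) = w x) :
    ∫⁻ x, ((w x * polar a u x : ℝ≥0) : ENNReal) = ∫⁻ x, ((w x * u x : ℝ≥0) : ENNReal) := by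
  have h2 : (2 : ENNReal) ≠ 0 := two_ne_zero
  refine (ENNReal.mul_right_inj h2 (by simp)).1 ?_
  rw [two_mul_lintegral_eq_hrefl a (by fun_prop), two_mul_lintegral_eq_hrefl a (by fun_prop)]
  congr 1 with x
  rw [hwa, ← ENNReal.coe_add, ← ENNReal.coe_add, ← mul_add, ← mul_add, polar_add_polar ha]

lemma Adm.polar {M : ℝ≥0} {u : ℝ × ℝ → ℝ≥0} (hu : Adm M u) {a : ℝ} (ha : a ≠ 0) :
    Adm M (polar a u) where
  meas := measurable_polar a hu.meas
  le_one x := by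
    unfold _root_.polar
    split_ifs
    · exact max_le (hu.le_one _) (hu.le_one _)
    · exact (min_le_left _ _).trans (hu.le_one _)
  supp x hx := by
    have h1 : u (hrefl a x) = 0 := hu.supp _ hx
    simp [_root_.polar, hu.supp x hx, h1]
  mass := by
    have := lintegral_mul_polar ha hu.meas (w := fun _ => 1) measurable_const (fun _ => rfl)
    simp only [one_mul] at this
    rw [this]; exact hu.mass
  imp := by
    rw [lintegral_mul_polar ha hu.meas (w := fun x => x.2.toNNReal) (by fun_prop) fun _ => rfl]
    exact hu.imp

lemma four_mul_en (a : ℝ) {u : ℝ × ℝ → ℝ≥0} (hu : Measurable u) :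
    2 * (2 * en u) = ∫⁻ x, ∫⁻ y,
      ((kern x y * (u x * u y + u (hrefl a x) * u (hrefl a y)) +
        kern x (hrefl a y) * (u x * u (hrefl a y) + u (hrefl a x) * u y) : ℝ≥0) : ENNReal) := by
  have hk := Measurable.coe_nnreal_ennreal (measurable_pair hu)
  have hm : Measurable fun x => ∫⁻ y, ((kern x y * u x * u y : ℝ≥0) : ENNReal) :=
    hk.lintegral_prod_right'
  have hmx : ∀ x, Measurable fun y => ((kern x y * u x * u y : ℝ≥0) : ENNReal) := fun x =>
    hk.comp measurable_prodMk_left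
  have hmx' : ∀ x, Measurable fun y => ((kern x y * u x * u y : ℝ≥0) : ENNReal) +
      ((kern x (hrefl a y) * u x * u (hrefl a y) : ℝ≥0) : ENNReal) := fun x =>
    (hmx x).add ((hmx x).comp (measurable_hrefl a))
  have hm2 : Measurable fun x => (∫⁻ y, ((kern x y * u x * u y : ℝ≥0) : ENNReal)) +
      ∫⁻ y, ((kern (hrefl a x) y * u (hrefl a x) * u y : ℝ≥0) : ENNReal) :=
    hm.add (hm.comp (measurable_hrefl a))
  rw [en, two_mul_lintegral_eq_hrefl a hm, 
    ← lintegral_const_mul 2 hm2]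
  congr 1 with x
  rw [mul_add, two_mul_lintegral_eq_hrefl a (hmx x), two_mul_lintegral_eq_hrefl a (hmx _),
    ← lintegral_add_left (hmx' x)]
  congr 1 with y
  rw [kern_hrefl_hrefl, kern_hrefl_left]
  norm_cast
  ring

lemma en_le_en_polar {a : ℝ} (ha : a ≠ 0) {u : ℝ × ℝ → ℝ≥0} (hu : Measurable u) :
    en u ≤ en (polar a u) := by
  have h2 : (2 : ENNReal) ≠ 0 := two_ne_zero
  refine (ENNReal.mul_le_mul_iff_right h2 (by simp)).1
    ((ENNReal.mul_le_mul_iff_right h2 (by simp)).1 ?_)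
  rw [four_mul_en a hu, four_mul_en a (measurable_polar a hu)]
  refine lintegral_mono fun x => lintegral_mono_ae ?_
  have hne : ∀ z : ℝ × ℝ, ∀ᵐ y, y ≠ z := fun z => by simp [ae_iff]
  filter_upwards [hne x, hne (hrefl a x)] with y hy1 hy2
  refine ENNReal.coe_le_coe.2 ?_
  have hsq : (x.1 - (hrefl a y).1) ^ 2 - (x.1 - y.1) ^ 2 = 4 * ((a - x.1) * (a - y.1)) := by
    simp only [hrefl]; ring
  have hy2' : x ≠ hrefl a y := fun h => hy2 (by rw [h, hrefl_hrefl])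
  have ha2 : 0 < a ^ 2 := by positivity
  have hprod : a ^ 2 * ((a - x.1) * (a - y.1)) = (a * a - a * x.1) * (a * a - a * y.1) := by ring
  have same : 0 ≤ (a * a - a * x.1) * (a * a - a * y.1) → kern x (hrefl a y) ≤ kern x y := by
    intro h
    rw [← hprod] at h
    have := nonneg_of_mul_nonneg_right h ha2
    exact kern_le_kern rfl hy1.symm (by linarith)
  have opp : (a * a - a * x.1) * (a * a - a * y.1) ≤ 0 → kern x y ≤ kern x (hrefl a y) := by
    intro h
    rw [← hprod] at h
    have : (a - x.1) * (a - y.1) ≤ 0 := by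
      by_contra! h0
      exact absurd h (not_le.2 (mul_pos ha2 h0))
    exact kern_le_kern rfl hy2' (by linarith)
  by_cases hx : a * x.1 < a * a <;> by_cases hy : a * y.1 < a * a
  · rw [(polar_near u hx).1, (polar_near u hx).2, (polar_near u hy).1, (polar_near u hy).2]
    exact rearrangement_le (same (by nlinarith))
  · rw [(polar_near u hx).1, (polar_near u hx).2, (polar_far ha u hy).1, (polar_far ha u hy).2]
    have := rearrangement_le (p := u x) (q := u (hrefl a x)) (r := u (hrefl a y)) (s := u y)
      (opp (by nlinarith))
    rw [max_comm (u (hrefl a y)), min_comm (u (hrefl a y))] at this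
    refine le_trans (le_of_eq (by ring)) (this.trans (le_of_eq (by ring)))
  · rw [(polar_far ha u hx).1, (polar_far ha u hx).2, (polar_near u hy).1, (polar_near u hy).2]
    have := rearrangement_le (p := u x) (q := u (hrefl a x)) (r := u (hrefl a y)) (s := u y)
      (opp (by nlinarith))
    rw [max_comm (u (hrefl a y)), min_comm (u (hrefl a y))] at this
    refine le_trans (le_of_eq (by ring)) (this.trans (le_of_eq (by ring)))
  · rw [(polar_far ha u hx).1, (polar_far ha u hx).2, (polar_far ha u hy).1, (polar_far ha u hy).2]
    refine (rearrangement_le (same (by nlinarith))).trans (le_of_eq (by ring))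

/-- The horizontal second moment. -/
def pen (u : ℝ × ℝ → ℝ≥0) : ENNReal := ∫⁻ x, (((x.1 ^ 2).toNNReal * u x : ℝ≥0) : ENNReal)

lemma weighted_polar_le {a : ℝ} (ha : a ≠ 0) (u : ℝ × ℝ → ℝ≥0) (x : ℝ × ℝ) :
    (x.1 ^ 2).toNNReal * polar a u x +
        ((hrefl a x).1 ^ 2).toNNReal * polar a u (hrefl a x) ≤
      (x.1 ^ 2).toNNReal * u x + ((hrefl a x).1 ^ 2).toNNReal * u (hrefl a x) := by
  have hsq : (hrefl a x).1 ^ 2 - x.1 ^ 2 = 4 * (a * a - a * x.1) := by simp only [hrefl]; ring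
  rw [← NNReal.coe_le_coe]
  push_cast
  rw [Real.coe_toNNReal _ (sq_nonneg _), Real.coe_toNNReal _ (sq_nonneg _)]
  by_cases hx : a * x.1 < a * a
  · rw [(polar_near u hx).1, (polar_near u hx).2]
    rcases le_total (u x) (u (hrefl a x)) with h | h
    · rw [max_eq_right h, min_eq_left h]
      have : (u x : ℝ) ≤ u (hrefl a x) := h
      nlinarith
    · rw [max_eq_left h, min_eq_right h]
  · rw [(polar_far ha u hx).1, (polar_far ha u hx).2]
    rcases le_total (u x) (u (hrefl a x)) with h | h
    · rw [max_eq_right h, min_eq_left h]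
    · rw [max_eq_left h, min_eq_right h]
      have : (u (hrefl a x) : ℝ) ≤ u x := h
      nlinarith

lemma pen_polar_le {a : ℝ} (ha : a ≠ 0) {u : ℝ × ℝ → ℝ≥0} (hu : Measurable u) :
    pen (polar a u) ≤ pen u := by
  refine (ENNReal.mul_le_mul_iff_right two_ne_zero (by simp)).1 ?_
  rw [pen, pen, two_mul_lintegral_eq_hrefl a (by fun_prop),
    two_mul_lintegral_eq_hrefl a (by fun_prop)]
  refine lintegral_mono fun x => ?_
  simpa only [ENNReal.coe_add] using ENNReal.coe_le_coe.2 (weighted_polar_le ha u x)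

lemma ae_hrefl_le_of_pen_le {a : ℝ} (ha : a ≠ 0) {u : ℝ × ℝ → ℝ≥0} (hu : Measurable u)
    (hfin : pen u ≠ ⊤) (h : pen u ≤ pen (polar a u)) :
    ∀ᵐ x : ℝ × ℝ, a * x.1 < a * a → u (hrefl a x) ≤ u x := by
  have h2 : 2 * pen u ≤ 2 * pen (polar a u) := by gcongr
  have h3 : 2 * pen (polar a u) ≠ ⊤ :=
    ENNReal.mul_ne_top (by simp) ((pen_polar_le ha hu).trans_lt hfin.lt_top).ne
  rw [pen, two_mul_lintegral_eq_hrefl a (by fun_prop)] at h3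
  rw [pen, pen, two_mul_lintegral_eq_hrefl a (by fun_prop),
    two_mul_lintegral_eq_hrefl a (by fun_prop)] at h2
  have hae := ae_eq_of_ae_le_of_lintegral_le
    (ae_of_all _ fun x => by exact_mod_cast weighted_polar_le ha u x) h3 (by fun_prop) h2
  filter_upwards [hae] with x hx hnear
  by_contra! hlt
  norm_cast at hx
  rw [(polar_near u hnear).1, (polar_near u hnear).2, max_eq_right hlt.le, min_eq_left hlt.le,
    ← NNReal.coe_inj] at hx
  push_cast at hx
  rw [Real.coe_toNNReal _ (sq_nonneg _), Real.coe_toNNReal _ (sq_nonneg _)] at hx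
  have hsq : (hrefl a x).1 ^ 2 - x.1 ^ 2 = 4 * (a * a - a * x.1) := by simp only [hrefl]; ring
  have : (u x : ℝ) < u (hrefl a x) := hlt
  have := mul_pos (sub_pos.2 hnear) (sub_pos.2 this)
  nlinarith

lemma lintegral_strip_le {u : ℝ × ℝ → ℝ≥0} (hu : Measurable u) {L t t' : ℝ}
    (hmono : ∀ᵐ x : ℝ × ℝ, (t + t') / 2 * x.1 < (t + t') / 2 * ((t + t') / 2) →
      u (hrefl ((t + t') / 2) x) ≤ u x)
    (h : (0 < t + t' ∧ 2 * L ≤ t - t') ∨ (t + t' < 0 ∧ 2 * L ≤ t' - t)) :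
    ∫⁻ x in {x : ℝ × ℝ | |x.1 - t| < L}, (u x : ENNReal) ≤
      ∫⁻ x in {x : ℝ × ℝ | |x.1 - t'| < L}, (u x : ENNReal) := by
  set a := (t + t') / 2 with ha
  have hpre : hrefl a ⁻¹' {x : ℝ × ℝ | |x.1 - t| < L} = {x : ℝ × ℝ | |x.1 - t'| < L} := by
    ext x
    have : 2 * a - x.1 - t = -(x.1 - t') := by rw [ha]; ring
    simp only [mem_preimage, mem_ofPred_eq, hrefl, this, abs_neg]
  have hs : ∀ t, MeasurableSet {x : ℝ × ℝ | |x.1 - t| < L} := fun t =>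
    measurableSet_lt (by fun_prop) measurable_const
  rw [← (measurePreserving_hrefl a).setLIntegral_comp_preimage (hs t) (by fun_prop), hpre]
  refine setLIntegral_mono_ae (by fun_prop) ?_
  filter_upwards [hmono] with x hx hxs
  refine ENNReal.coe_le_coe.2 (hx ?_)
  have hxs := abs_lt.1 (show |x.1 - t'| < L from hxs)
  rcases h with ⟨h1, h2⟩ | ⟨h1, h2⟩
  · exact mul_lt_mul_of_pos_left (by linarith) (by linarith)
  · exact mul_lt_mul_of_neg_left (by linarith) (by linarith)

lemma mul_lintegral_strip_le_one {M : ℝ≥0} {u : ℝ × ℝ → ℝ≥0} (hu : Adm M u)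
    (hmono : ∀ a ≠ 0, ∀ᵐ x : ℝ × ℝ, a * x.1 < a * a → u (hrefl a x) ≤ u x)
    {L : ℝ≥0} (hL : 0 < L) (N : ℕ) {t : ℝ} (ht : 2 * L * N < |t|) :
    N * ∫⁻ x in {x : ℝ × ℝ | |x.1 - t| < L}, (u x : ENNReal) ≤ 1 := by
  obtain ⟨σ, hσ, hσt⟩ : ∃ σ : ℝ, (σ = 1 ∨ σ = -1) ∧ |t| = σ * t := by
    rcases abs_choice t with h | h
    · exact ⟨1, Or.inl rfl, by rw [h, one_mul]⟩
    · exact ⟨-1, Or.inr rfl, by rw [h]; ring⟩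
  have hL' : (0 : ℝ) < L := hL
  set s : ℕ → Set (ℝ × ℝ) := fun k => {x | |x.1 - (t - σ * (2 * L * k))| < L} with hs
  have hsm : ∀ k, MeasurableSet (s k) := fun k => measurableSet_lt (by fun_prop) measurable_const
  have hdisj : Pairwise (Function.onFun Disjoint s) := by
    refine (pairwise_disjoint_on s).2 fun m n hmn => Set.disjoint_left.2 fun x h1 h2 => ?_
    have h1 := abs_lt.1 (show |x.1 - (t - σ * (2 * L * m))| < L from h1)
    have h2 := abs_lt.1 (show |x.1 - (t - σ * (2 * L * n))| < L from h2)
    have h3 : (m : ℝ) + 1 ≤ n := by exact_mod_cast hmn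
    have h4 : 2 * L * (m + 1) ≤ 2 * L * (n : ℝ) := by gcongr
    rcases hσ with rfl | rfl <;> linarith [h1.1, h1.2, h2.1, h2.2]
  have hle : ∀ k ∈ Finset.range N, ∫⁻ x in {x : ℝ × ℝ | |x.1 - t| < L}, (u x : ENNReal) ≤
      ∫⁻ x in s k, (u x : ENNReal) := by
    intro k hk
    rcases Nat.eq_zero_or_pos k with rfl | hk0
    · simp [hs]
    · have hkN : (k : ℝ) ≤ N := by exact_mod_cast (Finset.mem_range.1 hk).le
      have hk1 : (1 : ℝ) ≤ k := by exact_mod_cast hk0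
      have h1 : 2 * L * (k : ℝ) ≤ 2 * L * N := by gcongr
      have h2 : 2 * L * (1 : ℝ) ≤ 2 * L * k := by gcongr
      have hc : (0 < t + (t - σ * (2 * L * k)) ∧ 2 * L ≤ t - (t - σ * (2 * L * k))) ∨
          (t + (t - σ * (2 * L * k)) < 0 ∧ 2 * L ≤ t - σ * (2 * L * k) - t) := by
        rcases hσ with rfl | rfl
        · left; constructor <;> linarith
        · right; constructor <;> linarith
      refine lintegral_strip_le hu.meas (hmono _ ?_) hc
      rcases hc with hc | hc
      · exact (by linarith [hc.1] : 0 < (t + (t - σ * (2 * L * k))) / 2).ne'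
      · exact (by linarith [hc.1] : (t + (t - σ * (2 * L * k))) / 2 < 0).ne
  calc N * ∫⁻ x in {x : ℝ × ℝ | |x.1 - t| < L}, (u x : ENNReal)
      = ∑ k ∈ Finset.range N, ∫⁻ x in {x : ℝ × ℝ | |x.1 - t| < L}, (u x : ENNReal) := by simp
    _ ≤ ∑ k ∈ Finset.range N, ∫⁻ x in s k, (u x : ENNReal) := Finset.sum_le_sum hle
    _ = ∫⁻ x in ⋃ k ∈ Finset.range N, s k, (u x : ENNReal) :=
        (lintegral_biUnion_finset (fun i _ j _ hij => hdisj hij) (fun k _ => hsm k) _).symm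
    _ ≤ ∫⁻ x, (u x : ENNReal) := setLIntegral_le_lintegral _ _
    _ ≤ 1 := hu.mass

lemma tailsVanish_of_hrefl_le {M : ℝ≥0} {u : ℕ → ℝ × ℝ → ℝ≥0} (hu : ∀ n, Adm M (u n))
    (hmono : ∀ n, ∀ a ≠ 0, ∀ᵐ x : ℝ × ℝ, a * x.1 < a * a → u n (hrefl a x) ≤ u n x) :
    TailsVanish u := by
  intro L δ hL hδ
  obtain ⟨N, hN⟩ := exists_nat_ge δ⁻¹
  have hN0 : (0 : ℝ≥0) < N := (inv_pos.2 hδ).trans_le hN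
  refine ⟨2 * L * N + L, fun n t => ?_⟩
  by_cases ht : 2 * L * N < |t|
  · have h1 := mul_lintegral_strip_le_one (hu n) (hmono n) hL N ht
    refine (lintegral_mono_set inter_subset_right).trans ?_
    rw [mul_comm, ← ENNReal.le_div_iff_mul_le (by simp) (by simp)] at h1
    refine h1.trans ?_
    rw [one_div, ← ENNReal.coe_natCast, ← ENNReal.coe_inv hN0.ne', ENNReal.coe_le_coe]
    exact inv_le_of_inv_le₀ hδ hN
  · have : {x : ℝ × ℝ | 2 * L * N + L < |x.1|} ∩ {x | |x.1 - t| < L} = ∅ := by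
      refine eq_empty_of_forall_notMem fun x hx => ?_
      have h1 : 2 * L * N + L < |x.1| := hx.1
      have h2 : |x.1 - t| < L := hx.2
      have := abs_sub_abs_le_abs_sub x.1 t
      linarith
    rw [this]; simp

lemma lintegral_abs_fst_gt_le (u : ℝ × ℝ → ℝ≥0) (hu : Measurable u) {A : ℝ≥0} (hA : 0 < A) :
    ∫⁻ x in {x : ℝ × ℝ | (A : ℝ) < |x.1|}, (u x : ENNReal) ≤ (((A ^ 2)⁻¹ : ℝ≥0) : ENNReal) * pen u := by
  have hs : MeasurableSet {x : ℝ × ℝ | (A : ℝ) < |x.1|} :=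
    measurableSet_lt measurable_const (by fun_prop)
  rw [pen, ← lintegral_const_mul _ (by fun_prop)]
  refine (setLIntegral_mono' hs fun x hx => ?_).trans (setLIntegral_le_lintegral _ _)
  rw [← ENNReal.coe_mul, ENNReal.coe_le_coe, ← mul_assoc]
  refine le_mul_of_one_le_left' ?_
  rw [inv_mul_eq_div, one_le_div (by positivity)]
  refine NNReal.le_toNNReal_of_coe_le ?_
  push_cast
  rw [← sq_abs x.1]
  have : (A : ℝ) < |x.1| := hx
  gcongr

lemma adm_zero (M : ℝ≥0) : Adm M fun _ => 0 where
  meas := measurable_const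
  le_one _ := zero_le_one
  supp _ _ := rfl
  mass := by simp
  imp := by simp

lemma tailsVanish_of_pen_le {u : ℕ → ℝ × ℝ → ℝ≥0} (hu : ∀ n, Measurable (u n)) {c : ℝ≥0}
    (hc : ∀ n, pen (u n) ≤ c) : TailsVanish u := by
  intro L δ _ hδ
  set A : ℝ≥0 := NNReal.sqrt (c / δ) + 1 with hA
  have hA0 : 0 < A := by positivity
  refine ⟨A, fun n t => ?_⟩
  refine (lintegral_mono_set inter_subset_left).trans
    ((lintegral_abs_fst_gt_le _ (hu n) hA0).trans ?_)
  calc _ ≤ (((A ^ 2)⁻¹ : ℝ≥0) : ENNReal) * c := by gcongr; exact hc n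
    _ ≤ δ := by
      rw [← ENNReal.coe_mul, ENNReal.coe_le_coe, inv_mul_le_iff₀ (by positivity)]
      rw [← div_le_iff₀ hδ, ← NNReal.sqrt_le_iff_le_sq]
      exact le_self_add

lemma exists_penalized_maximizer (M : ℝ≥0) {ε : ℝ} (hε : 0 < ε) :
    ∃ v, Adm M v ∧ pen v ≠ ⊤ ∧ ∀ u, Adm M u → pen u ≠ ⊤ →
      (en u).toReal - ε * (pen u).toReal ≤ (en v).toReal - ε * (pen v).toReal := by
  obtain ⟨C, hC⟩ := Adm.en_lt_top (M := M)
  have hCr : ∀ u, Adm M u → (en u).toReal ≤ C := fun u hu =>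
    ENNReal.toReal_le_coe_of_le_coe (hC u hu)
  set J : (ℝ × ℝ → ℝ≥0) → ℝ := fun u => (en u).toReal - ε * (pen u).toReal with hJ
  set S : Set ℝ := J '' {u | Adm M u ∧ pen u ≠ ⊤} with hS
  have hbdd : BddAbove S := by
    refine ⟨C, ?_⟩
    rintro _ ⟨u, ⟨hu, -⟩, rfl⟩
    have : 0 ≤ ε * (pen u).toReal := by positivity
    simp only [hJ]
    linarith [hCr u hu]
  have h0 : (0 : ℝ) ∈ S := by
    refine ⟨fun _ => 0, ⟨adm_zero M, by simp [pen]⟩, ?_⟩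
    simp [hJ, en, pen]
  have hs0 : 0 ≤ sSup S := le_csSup hbdd h0
  have hex : ∀ n : ℕ, ∃ u, Adm M u ∧ pen u ≠ ⊤ ∧ sSup S - 1 / ((n : ℝ) + 1) < J u := by
    intro n
    obtain ⟨_, ⟨u, ⟨hu, hp⟩, rfl⟩, hlt⟩ := exists_lt_of_lt_csSup ⟨0, h0⟩
      (sub_lt_self (sSup S) (Nat.one_div_pos_of_nat (α := ℝ) (n := n)))
    exact ⟨u, hu, hp, hlt⟩
  choose u hu hp hlt using hex
  have hpb : ∀ n, pen (u n) ≤ (((C + 1) / ε.toNNReal : ℝ≥0) : ENNReal) := by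
    intro n
    rw [← ENNReal.toReal_le_toReal (hp n) ENNReal.coe_ne_top, ENNReal.coe_toReal]
    push_cast
    rw [Real.coe_toNNReal _ hε.le, le_div_iff₀ hε]
    have h1 := hlt n
    have h2 : 1 / ((n : ℝ) + 1) ≤ 1 := by
      rw [div_le_one (by positivity)]
      linarith [n.cast_nonneg (α := ℝ)]
    simp only [hJ] at h1
    linarith [hCr _ (hu n)]
  obtain ⟨v, hv, φ, hφ, hw⟩ := exists_weak_limit hu
  have htails : TailsVanish fun n => u (φ n) :=
    tailsVanish_of_pen_le (fun n => (hu _).meas) fun n => hpb (φ n)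
  have hE := tendsto_en (fun n => hu (φ n)) hv hw htails
  have hlim : Tendsto (fun n => ((en (u (φ n))).toReal - sSup S + 1 / ((φ n : ℝ) + 1)) / ε) atTop
      (𝓝 (((en v).toReal - sSup S + 0) / ε)) :=
    ((hE.sub_const _).add (tendsto_one_div_add_atTop_nhds_zero_nat.comp hφ.tendsto_atTop)).div_const _
  rw [add_zero] at hlim
  have hpv : ∀ c > ((en v).toReal - sSup S) / ε, 0 ≤ c ∧ pen v ≤ ENNReal.ofReal c := by
    intro c hc
    have hev : ∀ᶠ n in atTop, (pen (u (φ n))).toReal ≤ c := by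
      filter_upwards [hlim.eventually_lt_const hc] with n hn
      refine le_trans ?_ hn.le
      rw [le_div_iff₀ hε]
      have := hlt (φ n)
      simp only [hJ] at this
      linarith
    obtain ⟨n, hn⟩ := hev.exists
    have hc0 : 0 ≤ c := ENNReal.toReal_nonneg.trans hn
    refine ⟨hc0, hw.lintegral_le (fun n => (hu _).meas) (fun n => (hu _).le_one) hv.meas hv.le_one
      (by fun_prop) ?_⟩
    filter_upwards [hev] with n hn
    exact (ENNReal.le_ofReal_iff_toReal_le (hp _) hc0).2 hn
  have hfin : pen v ≠ ⊤ := ((hpv _ (lt_add_one _)).2.trans_lt ENNReal.ofReal_lt_top).ne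
  refine ⟨v, hv, hfin, fun w hw1 hw2 => (le_csSup hbdd ⟨w, ⟨hw1, hw2⟩, rfl⟩).trans ?_⟩
  have : (pen v).toReal ≤ ((en v).toReal - sSup S) / ε :=
    le_of_forall_gt_imp_ge_of_dense fun c hc =>
      ENNReal.toReal_le_of_le_ofReal (hpv c hc).1 (hpv c hc).2
  rw [le_div_iff₀ hε] at this
  linarith

lemma exists_en_maximizer_of_pen_ne_top (M : ℝ≥0) :
    ∃ v, Adm M v ∧ ∀ u, Adm M u → pen u ≠ ⊤ → (en u).toReal ≤ (en v).toReal := by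
  obtain ⟨C, hC⟩ := Adm.en_lt_top (M := M)
  have hfin : ∀ w, Adm M w → en w ≠ ⊤ := fun w hw =>
    ((hC w hw).trans_lt ENNReal.coe_lt_top).ne
  choose v hv hp hmax using fun n : ℕ => exists_penalized_maximizer M
    (Nat.one_div_pos_of_nat (α := ℝ) (n := n))
  have hmono : ∀ n, ∀ a ≠ 0, ∀ᵐ x : ℝ × ℝ, a * x.1 < a * a → v n (hrefl a x) ≤ v n x := by
    intro n a ha
    have hpol := (pen_polar_le ha (hv n).meas).trans_lt (hp n).lt_top
    refine ae_hrefl_le_of_pen_le ha (hv n).meas (hp n) ?_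
    have h1 := hmax n _ ((hv n).polar ha) hpol.ne
    have h2 := ENNReal.toReal_mono (hfin _ ((hv n).polar ha)) (en_le_en_polar ha (hv n).meas)
    rw [← ENNReal.toReal_le_toReal (hp n) hpol.ne]
    exact le_of_mul_le_mul_left (by linarith) (Nat.one_div_pos_of_nat (α := ℝ) (n := n))
  have ht := tailsVanish_of_hrefl_le hv hmono
  obtain ⟨w, hw, φ, hφ, hlim⟩ := exists_weak_limit hv
  have ht' : TailsVanish fun n => v (φ n) := by
    intro L δ hL hδ
    obtain ⟨A, hA⟩ := ht L δ hL hδ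
    exact ⟨A, fun n => hA (φ n)⟩
  have hE := tendsto_en (fun n => hv (φ n)) hw hlim ht'
  refine ⟨w, hw, fun u hu hpu => ?_⟩
  have h1 : Tendsto (fun n => (en u).toReal - 1 / ((φ n : ℝ) + 1) * (pen u).toReal) atTop
      (𝓝 ((en u).toReal - 0 * (pen u).toReal)) :=
    ((tendsto_one_div_add_atTop_nhds_zero_nat.comp hφ.tendsto_atTop).mul_const _).const_sub _
  rw [zero_mul, sub_zero] at h1
  refine le_of_tendsto_of_tendsto' h1 hE fun n => (hmax (φ n) u hu hpu).trans ?_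
  have : 0 ≤ 1 / ((φ n : ℝ) + 1) * (pen (v (φ n))).toReal := by positivity
  linarith

lemma exists_en_maximizer (M : ℝ≥0) :
    ∃ v, Adm M v ∧ ∀ u, Adm M u → (en u).toReal ≤ (en v).toReal := by
  obtain ⟨C, hC⟩ := Adm.en_lt_top (M := M)
  have hfin : ∀ w, Adm M w → en w ≠ ⊤ := fun w hw =>
    ((hC w hw).trans_lt ENNReal.coe_lt_top).ne
  obtain ⟨v, hv, hmax⟩ := exists_en_maximizer_of_pen_ne_top M
  refine ⟨v, hv, fun u hu => ENNReal.toReal_mono (hfin v hv) ?_⟩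
  have hum := hu.meas
  set s : ℕ → Set (ℝ × ℝ) := fun k => {x | |x.1| ≤ k} with hs
  have hsm : ∀ k, MeasurableSet (s k) := fun k => measurableSet_le (by fun_prop) measurable_const
  have hsmono : Monotone s := fun i j hij x hx => by
    have h1 : |x.1| ≤ i := hx
    exact h1.trans (by exact_mod_cast hij)
  set t : ℕ → ℝ × ℝ → ℝ≥0 := fun k => (s k).indicator u with ht
  have htm : ∀ k, Measurable (t k) := fun k => hum.indicator (hsm k)
  have htu : ∀ k x, t k x ≤ u x := fun k x => indicator_le_self' (by simp) x
  have hmono : ∀ x, Monotone fun k => t k x := fun x i j hij =>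
    indicator_le_indicator_of_subset (hsmono hij) (by simp) x
  have hadm : ∀ k, Adm M (t k) := fun k =>
    { meas := htm k
      le_one := fun x => (htu k x).trans (hu.le_one x)
      supp := fun x hx => le_antisymm ((htu k x).trans_eq (hu.supp x hx)) zero_le
      mass := (lintegral_mono fun x => ENNReal.coe_le_coe.2 (htu k x)).trans hu.mass
      imp := (lintegral_mono fun x => ENNReal.coe_le_coe.2
        (mul_le_mul_right (htu k x) _)).trans hu.imp }
  have hpen : ∀ k, pen (t k) ≠ ⊤ := by
    intro k
    have : pen (t k) ≤ ((k : ℝ≥0) ^ 2 : ℝ≥0) * 1 := by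
      calc pen (t k) ≤ ∫⁻ x, (((k : ℝ≥0) ^ 2 : ℝ≥0) : ENNReal) * (u x : ENNReal) := by
            refine lintegral_mono fun x => ?_
            rw [← ENNReal.coe_mul, ENNReal.coe_le_coe]
            by_cases hx : x ∈ s k
            · simp only [ht, indicator_of_mem hx]
              gcongr
              refine Real.toNNReal_le_iff_le_coe.2 ?_
              push_cast
              rw [← sq_abs]
              have : |x.1| ≤ k := hx
              gcongr
            · simp [ht, indicator_of_notMem hx]
        _ = (((k : ℝ≥0) ^ 2 : ℝ≥0) : ENNReal) * ∫⁻ x, (u x : ENNReal) :=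
            lintegral_const_mul _ (by fun_prop)
        _ ≤ _ := by gcongr; exact hu.mass
    exact (this.trans_lt (by rw [mul_one]; exact ENNReal.coe_lt_top)).ne
  have hevent : ∀ x, ∀ᶠ k in atTop, t k x = u x := by
    intro x
    obtain ⟨N, hN⟩ := exists_nat_ge |x.1|
    filter_upwards [eventually_ge_atTop N] with k hk
    exact indicator_of_mem (hsmono hk (show x ∈ s N from hN)) _
  have hk : ∀ k, Measurable fun p : (ℝ × ℝ) × (ℝ × ℝ) =>
      ((kern p.1 p.2 * t k p.1 * t k p.2 : ℝ≥0) : ENNReal) := fun k =>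
    Measurable.coe_nnreal_ennreal (measurable_pair (htm k))
  have hpmono : ∀ x y, Monotone fun k => ((kern x y * t k x * t k y : ℝ≥0) : ENNReal) := by
    intro x y i j hij
    refine ENNReal.coe_le_coe.2 ?_
    have h1 := hmono x hij
    have h2 := hmono y hij
    simp only at h1 h2
    gcongr
  have hlim : Tendsto (fun k => en (t k)) atTop (𝓝 (en u)) := by
    refine lintegral_tendsto_of_tendsto_of_monotone
      (fun k => (hk k).lintegral_prod_right'.aemeasurable)
      (ae_of_all _ fun x i j hij => lintegral_mono fun y => hpmono x y hij)
      (ae_of_all _ fun x => ?_)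
    refine lintegral_tendsto_of_tendsto_of_monotone
      (fun k => ((hk k).comp measurable_prodMk_left).aemeasurable)
      (ae_of_all _ fun y => hpmono x y) (ae_of_all _ fun y => ?_)
    refine tendsto_const_nhds.congr' ?_
    filter_upwards [hevent x, hevent y] with k h1 h2
    rw [h1, h2]
  refine le_of_tendsto' hlim fun k => ?_
  exact (ENNReal.toReal_le_toReal (hfin _ (hadm k)) (hfin v hv)).1 (hmax _ (hadm k) (hpen k))

lemma measurableSet_H : MeasurableSet H := measurableSet_lt measurable_const measurable_snd

lemma setLIntegral_H_eq {f : ℝ × ℝ → ENNReal} (hf : ∀ x, x ∉ H → f x = 0) :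
    ∫⁻ x in H, f x = ∫⁻ x, f x := by
  rw [← lintegral_indicator measurableSet_H, indicator_eq_self.2]
  intro x hx
  by_contra h
  exact hx (hf x h)

lemma Adm.energy_eq {M : ℝ≥0} {u : ℝ × ℝ → ℝ≥0} (hu : Adm M u) {ω : ℝ × ℝ → ℝ}
    (hω : ∀ᵐ x ∂volume.restrict H, ω x = u x) : energy ω = 1 / 2 * (en u).toReal := by
  obtain ⟨C, hC⟩ := Adm.en_lt_top (M := M)
  have h1 : ∫⁻ x in H, ∫⁻ y in H, ((kern x y * u x * u y : ℝ≥0) : ENNReal) = en u := by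
    rw [en, setLIntegral_H_eq fun x hx => by simp [hu.supp x hx]]
    congr 1 with x
    exact setLIntegral_H_eq fun y hy => by simp [hu.supp y hy]
  rw [energy, ← h1, ← integral_integral_eq_toReal (measurable_pair hu.meas)
    (by rw [h1]; exact ((hC u hu).trans_lt ENNReal.coe_lt_top).ne)]
  congr 1
  refine integral_congr_ae ?_
  filter_upwards [hω, ae_restrict_mem measurableSet_H] with x hx hxH
  refine integral_congr_ae ?_
  filter_upwards [hω, ae_restrict_mem measurableSet_H] with y hy hyH
  rw [hx, hy, NNReal.coe_mul, NNReal.coe_mul, coe_kern hxH hyH]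

lemma Adm.memKt {M : ℝ≥0} {u : ℝ × ℝ → ℝ≥0} (hu : Adm M u) :
    memKt M fun x => (u x : ℝ) := by
  have hum := hu.meas
  have hmass : ∫⁻ x in H, (u x : ENNReal) ≤ 1 := (setLIntegral_le_lintegral _ _).trans hu.mass
  have himp : ∫⁻ x in H, ((x.2.toNNReal * u x : ℝ≥0) : ENNReal) ≤ M :=
    (setLIntegral_le_lintegral _ _).trans hu.imp
  have heq : EqOn (fun x : ℝ × ℝ => ((x.2.toNNReal * u x : ℝ≥0) : ℝ))
      (fun x => x.2 * |(u x : ℝ)|) H := by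
    intro x hx
    have hx : 0 < x.2 := hx
    simp [hx.le]
  have hint : ∀ {f : ℝ × ℝ → ℝ≥0}, Measurable f → ∀ {c : ℝ≥0}, ∫⁻ x in H, (f x : ENNReal) ≤ c →
      IntegrableOn (fun x => (f x : ℝ)) H ∧ ∫ x in H, (f x : ℝ) ≤ c := by
    intro f hf c hc
    refine ⟨⟨by fun_prop, ?_⟩, ?_⟩
    · refine lt_of_le_of_lt (le_of_eq ?_) (hc.trans_lt ENNReal.coe_lt_top)
      congr 1 with x
      rw [Real.enorm_eq_ofReal (NNReal.coe_nonneg _), ENNReal.ofReal_coe_nnreal]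
    · rw [integral_eq_lintegral_of_nonneg_ae (ae_of_all _ fun y => NNReal.coe_nonneg _)
        (by fun_prop)]
      simp only [ENNReal.ofReal_coe_nnreal]
      exact ENNReal.toReal_le_coe_of_le_coe hc
  have h1 := hint hum (c := 1) (by simpa using hmass)
  have h2 := hint (f := fun x => x.2.toNNReal * u x) (by fun_prop) himp
  refine ⟨h1.1, ae_of_all _ fun x => ⟨(u x).coe_nonneg, by exact_mod_cast hu.le_one x⟩, ?_,
    h2.1.congr_fun heq measurableSet_H, ?_⟩
  · simpa [norm1] using h1.2
  · rw [impulse, ← setIntegral_congr_fun measurableSet_H heq]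
    exact h2.2

lemma exists_adm_of_memKt {M : ℝ≥0} {ω : ℝ × ℝ → ℝ} (hω : memKt M ω) :
    ∃ u, Adm M u ∧ ∀ᵐ x ∂volume.restrict H, ω x = (u x : ℝ) := by
  obtain ⟨hint, h01, hmass, hint', himp⟩ := hω
  set g := hint.1.mk ω with hg
  have hgm : Measurable g := hint.1.stronglyMeasurable_mk.measurable
  set u : ℝ × ℝ → ℝ≥0 := H.indicator fun x => min (g x).toNNReal 1 with hu
  have hum : Measurable u := (hgm.real_toNNReal.min measurable_const).indicator measurableSet_H
  have hae : ∀ᵐ x ∂volume.restrict H, ω x = (u x : ℝ) := by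
    filter_upwards [hint.1.ae_eq_mk, h01, ae_restrict_mem measurableSet_H] with x h1 h2 h3
    rw [← hg] at h1
    rw [hu, indicator_of_mem h3, ← h1]
    push_cast
    rw [Real.coe_toNNReal _ h2.1, min_eq_left h2.2]
  have hsupp : ∀ x, x ∉ H → u x = 0 := fun x hx => indicator_of_notMem hx _
  refine ⟨u, ⟨hum, fun x => ?_, hsupp, ?_, ?_⟩, hae⟩
  · exact (indicator_le_self' (fun _ _ => zero_le) x).trans (min_le_right _ _)
  · rw [← setLIntegral_H_eq fun x hx => by simp [hsupp x hx]]
    calc ∫⁻ x in H, (u x : ENNReal) = ∫⁻ x in H, ENNReal.ofReal |ω x| := by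
          refine lintegral_congr_ae ?_
          filter_upwards [hae] with x hx
          rw [hx, NNReal.abs_eq, ENNReal.ofReal_coe_nnreal]
      _ = ENNReal.ofReal (norm1 ω) :=
          (ofReal_integral_eq_lintegral_ofReal hint.abs (ae_of_all _ fun x => abs_nonneg _)).symm
      _ ≤ 1 := by rwa [ENNReal.ofReal_le_one]
  · rw [← setLIntegral_H_eq fun x hx => by simp [hsupp x hx]]
    calc ∫⁻ x in H, ((x.2.toNNReal * u x : ℝ≥0) : ENNReal)
        = ∫⁻ x in H, ENNReal.ofReal (x.2 * |ω x|) := by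
          refine lintegral_congr_ae ?_
          filter_upwards [hae, ae_restrict_mem measurableSet_H] with x hx hxH
          have h0 : 0 < x.2 := hxH
          rw [hx, NNReal.abs_eq, ENNReal.ofReal_mul h0.le, ENNReal.ofReal_coe_nnreal,
            ENNReal.coe_mul]
          rfl
      _ = ENNReal.ofReal (impulse ω) := by
          refine (ofReal_integral_eq_lintegral_ofReal hint' ?_).symm
          filter_upwards [ae_restrict_mem measurableSet_H] with x hxH
          have h0 : 0 < x.2 := hxH
          exact mul_nonneg h0.le (abs_nonneg _)
      _ ≤ M := by
          rw [← ENNReal.ofReal_coe_nnreal]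
          exact ENNReal.ofReal_le_ofReal himp

/-- for each `M > 0` the kinetic energy attains its maximum over the
relaxed admissible class `K̃_M`. -/
theorem exists_relaxed_maximizer (M : ℝ) (hM : 0 < M) :
    ∃ ω : ℝ × ℝ → ℝ, memKt M ω ∧
      ∀ ω' : ℝ × ℝ → ℝ, memKt M ω' → energy ω' ≤ energy ω := by
  lift M to ℝ≥0 using hM.le
  obtain ⟨v, hv, hmax⟩ := exists_en_maximizer M
  refine ⟨fun x => v x, hv.memKt, fun ω' hω' => ?_⟩
  obtain ⟨u, hu, hae⟩ := exists_adm_of_memKt hω'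
  rw [hu.energy_eq hae, hv.energy_eq (ae_of_all _ fun _ => rfl)]
  linarith [hmax u hu]
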